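/- There exists an absolute constant C > 0 such that for every finite signed graph (Γ,s) without isolated vertices and every j ∈ {1,…,N}, the j-way signed Cheeger constant h_j^s and the j-th eigenvalue λ_j of the signed normalized Laplacian satisfy (h_j^s)² / (C j⁶) ≤ λ_j ≤ 2 h_j^s. -/

import Mathlib

open scoped BigOperators

/-- The signed normalized Laplacian of a signed graph `(Γ,s)`:
`Δ_s f(v) = f(v) − (1/deg v) Σ_{u∼v} s(vu) f(u)`. -/
noncomputable def slap {V : Type*} [Fintype V] (G : SimpleGraph V) [DecidableRel G.Adj]
    (s : V → V → ℝ) (f : V → ℝ) : V → ℝ :=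
  fun v => f v - (∑ u ∈ G.neighborFinset v, s v u * f u) / (G.degree v : ℝ)

/-- The signed bipartiteness ratio `β^s(V₁,V₂)` of a pair of disjoint vertex sets:
`[2(|E⁻(V₁)| + |E⁻(V₂)| + |E⁺(V₁,V₂)|) + |∂(V₁⊔V₂)|] / vol(V₁⊔V₂)`.
(Sums over ordered pairs count each edge inside a set twice.) -/
noncomputable def signedBeta {V : Type*} [Fintype V] [DecidableEq V] (G : SimpleGraph V)
    [DecidableRel G.Adj] (s : V → V → ℝ) (A B : Finset V) : ℝ :=
  ((∑ u ∈ A, ∑ v ∈ A, if G.Adj u v ∧ s u v = -1 then (1 : ℝ) else 0) +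
    (∑ u ∈ B, ∑ v ∈ B, if G.Adj u v ∧ s u v = -1 then (1 : ℝ) else 0) +
    2 * (∑ u ∈ A, ∑ v ∈ B, if G.Adj u v ∧ s u v = 1 then (1 : ℝ) else 0) +
    (∑ u ∈ A ∪ B, ∑ v ∈ (A ∪ B)ᶜ, if G.Adj u v then (1 : ℝ) else 0)) /
    ∑ v ∈ A ∪ B, (G.degree v : ℝ)

/-- The signed Cheeger constant `h₁^s`: the minimum of `β^s(V₁,V₂)` over all pairs of disjoint
subsets `(V₁,V₂) ≠ (∅,∅)`. -/
noncomputable def signedCheeger {V : Type*} [Fintype V] [DecidableEq V] (G : SimpleGraph V)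
    [DecidableRel G.Adj] (s : V → V → ℝ) : ℝ :=
  sInf { r : ℝ | ∃ A B : Finset V, Disjoint A B ∧ (A ∪ B).Nonempty ∧
    r = signedBeta G s A B }

/-- The `j`-way signed Cheeger constant `h_j^s`: the minimum over all families of `j` pairs
`(V₁,V₂), …, (V_{2j−1},V_{2j})` of pairwise disjoint subsets of `V`, each pair not both empty,
of `max_{1≤i≤j} β^s(V_{2i−1},V_{2i})`. -/
noncomputable def signedCheegerJ {V : Type*} [Fintype V] [DecidableEq V] (G : SimpleGraph V)
    [DecidableRel G.Adj] (s : V → V → ℝ) (j : ℕ) : ℝ :=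
  sInf { r : ℝ | ∃ P : Fin j → Finset V × Finset V,
    (∀ i, Disjoint (P i).1 (P i).2) ∧
    (∀ i, ((P i).1 ∪ (P i).2).Nonempty) ∧
    (∀ i i', i ≠ i' → Disjoint ((P i).1 ∪ (P i).2) ((P i').1 ∪ (P i').2)) ∧
    r = sSup (Set.range fun i => signedBeta G s (P i).1 (P i).2) }

/-- The distance from `x` to the lattice `mℤ`, truncated at `1`. -/
noncomputable def latticeDist (m : ℕ) (x : ℝ) : ℝ :=
  min 1 (min (x - m * ⌊x / m⌋) (m * (⌊x / m⌋ + 1) - x))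

/-- How much a cutoff that vanishes on `mℤ` can differ at `x` and `y`: the variation of
`latticeDist` if the two points lie in the same cell of `mℤ`, and its maximum otherwise. -/
noncomputable def latticeGap (m : ℕ) (x y : ℝ) : ℝ :=
  if ⌊x / m⌋ = ⌊y / m⌋ then |latticeDist m x - latticeDist m y|
  else max (latticeDist m x) (latticeDist m y)

lemma floor_div_mul_le {m : ℕ} (hm : 0 < m) (x : ℝ) : (m : ℝ) * ⌊x / m⌋ ≤ x := by
  have hm' : (0 : ℝ) < m := by exact_mod_cast hm
  have := Int.floor_le (x / m)
  rw [le_div_iff₀ hm'] at this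
  linarith

lemma lt_mul_floor_div_add_one {m : ℕ} (hm : 0 < m) (x : ℝ) :
    x < (m : ℝ) * (⌊x / m⌋ + 1) := by
  have hm' : (0 : ℝ) < m := by exact_mod_cast hm
  have := Int.lt_floor_add_one (x / m)
  rw [div_lt_iff₀ hm'] at this
  linarith

lemma latticeDist_nonneg {m : ℕ} (hm : 0 < m) (x : ℝ) : 0 ≤ latticeDist m x := by
  have h1 := floor_div_mul_le hm x
  have h2 := lt_mul_floor_div_add_one hm x
  exact le_min zero_le_one (le_min (by linarith) (by linarith))

lemma latticeDist_le_one (m : ℕ) (x : ℝ) : latticeDist m x ≤ 1 := min_le_left _ _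

lemma exists_lattice_near_of_latticeDist_lt_one {m : ℕ} (hm : 0 < m) {x : ℝ}
    (hx : latticeDist m x < 1) :
    ∃ n : ℤ, x - 1 ≤ m * n ∧ (m : ℝ) * n ≤ x + 1 := by
  have h1 := floor_div_mul_le hm x
  have h2 := lt_mul_floor_div_add_one hm x
  rw [latticeDist, min_lt_iff, min_lt_iff] at hx
  rcases hx with h | h | h
  · exact absurd h (lt_irrefl _)
  · exact ⟨⌊x / m⌋, by linarith, by linarith⟩
  · exact ⟨⌊x / m⌋ + 1, by push_cast; linarith, by push_cast; linarith⟩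

lemma exists_lattice_between {m : ℕ} (hm : 0 < m) {x y : ℝ} (h : ⌊x / m⌋ < ⌊y / m⌋) :
    latticeDist m x ≤ y - x ∧ latticeDist m y ≤ y - x ∧
      ∃ n : ℤ, x ≤ m * n ∧ (m : ℝ) * n ≤ y := by
  have hm' : (0 : ℝ) < m := by exact_mod_cast hm
  have h2 := lt_mul_floor_div_add_one hm x
  have h3 := floor_div_mul_le hm y
  have h4 : (⌊x / m⌋ : ℝ) + 1 ≤ ⌊y / m⌋ := by exact_mod_cast h
  have h5 : (m : ℝ) * (⌊x / m⌋ + 1) ≤ m * ⌊y / m⌋ := by gcongr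
  refine ⟨?_, ?_, ⌊y / m⌋, by linarith, h3⟩
  · exact (min_le_right _ _).trans ((min_le_right _ _).trans (by linarith))
  · exact (min_le_right _ _).trans ((min_le_left _ _).trans (by linarith))

lemma latticeGap_nonneg {m : ℕ} (hm : 0 < m) (x y : ℝ) : 0 ≤ latticeGap m x y := by
  unfold latticeGap
  split_ifs
  · exact abs_nonneg _
  · exact (latticeDist_nonneg hm x).trans (le_max_left _ _)

lemma latticeGap_le_one {m : ℕ} (hm : 0 < m) (x y : ℝ) : latticeGap m x y ≤ 1 := by
  have h1 := latticeDist_nonneg hm x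
  have h2 := latticeDist_nonneg hm y
  have h3 := latticeDist_le_one m x
  have h4 := latticeDist_le_one m y
  unfold latticeGap
  split_ifs
  · rw [abs_le]; constructor <;> linarith
  · exact max_le h3 h4

lemma latticeGap_le_abs_sub {m : ℕ} (hm : 0 < m) (x y : ℝ) : latticeGap m x y ≤ |x - y| := by
  unfold latticeGap
  split_ifs with h
  · unfold latticeDist
    rw [h]
    refine (abs_min_sub_min_le_max _ _ _ _).trans (max_le (by simp) ?_)
    refine (abs_min_sub_min_le_max _ _ _ _).trans (max_le (le_of_eq ?_) (le_of_eq ?_))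
    · congr 1; ring
    · rw [abs_sub_comm]; congr 1; ring
  · rcases lt_or_gt_of_ne h with h | h
    · obtain ⟨h1, h2, -⟩ := exists_lattice_between hm h
      rw [abs_sub_comm]
      exact (max_le h1 h2).trans (le_abs_self _)
    · obtain ⟨h1, h2, -⟩ := exists_lattice_between hm h
      exact (max_le h2 h1).trans (le_abs_self _)

lemma exists_lattice_near_of_latticeGap_ne_zero {m : ℕ} (hm : 0 < m) {x y : ℝ}
    (h : latticeGap m x y ≠ 0) :
    ∃ n : ℤ, min x y - 1 ≤ m * n ∧ (m : ℝ) * n ≤ max x y + 1 := by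
  have a1 := min_le_left x y
  have a2 := min_le_right x y
  have a3 := le_max_left x y
  have a4 := le_max_right x y
  by_cases hxy : ⌊x / m⌋ = ⌊y / m⌋
  · rw [latticeGap, if_pos hxy] at h
    have : latticeDist m x < 1 ∨ latticeDist m y < 1 := by
      by_contra! hc
      have e1 := le_antisymm (latticeDist_le_one m x) hc.1
      have e2 := le_antisymm (latticeDist_le_one m y) hc.2
      simp [e1, e2] at h
    rcases this with h | h
    · obtain ⟨n, h1, h2⟩ := exists_lattice_near_of_latticeDist_lt_one hm h
      exact ⟨n, by linarith, by linarith⟩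
    · obtain ⟨n, h1, h2⟩ := exists_lattice_near_of_latticeDist_lt_one hm h
      exact ⟨n, by linarith, by linarith⟩
  · rcases lt_or_gt_of_ne hxy with h | h
    · obtain ⟨-, -, n, h1, h2⟩ := exists_lattice_between hm h
      exact ⟨n, by linarith, by linarith⟩
    · obtain ⟨-, -, n, h1, h2⟩ := exists_lattice_between hm h
      exact ⟨n, by linarith, by linarith⟩

/-- Among the `m` integer shifts of a lattice `mℤ`, few meet a given interval. -/
lemma card_shifts_le {m : ℕ} (S : Finset ℕ) (hS : S ⊆ Finset.range m) {a b : ℝ}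
    (hab : a ≤ b) (h : ∀ t ∈ S, ∃ n : ℤ, a + t ≤ m * n ∧ (m : ℝ) * n ≤ b + t) :
    (S.card : ℝ) ≤ b - a + 1 := by
  choose! n hn using h
  have hcard : S.card ≤ (Finset.Icc ⌈a⌉ ⌊b⌋).card := by
    refine Finset.card_le_card_of_injOn (fun t => (m : ℤ) * n t - t) ?_ ?_
    · intro t ht
      obtain ⟨h1, h2⟩ := hn t ht
      simp only [Finset.coe_Icc, Set.mem_Icc, Int.ceil_le, Int.le_floor]
      push_cast
      constructor <;> linarith
    · intro t ht t' ht' heq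
      have h1 := Finset.mem_range.1 (hS ht)
      have h2 := Finset.mem_range.1 (hS ht')
      simp only at heq
      have h3 : (t : ℤ) ≡ t' [ZMOD m] := by
        rw [Int.modEq_iff_dvd]
        exact ⟨n t' - n t, by linarith⟩
      have h4 : t ≡ t' [MOD m] := (Int.natCast_modEq_iff).1 h3
      exact Nat.ModEq.eq_of_lt_of_lt h4 h1 h2
  rw [Int.card_Icc] at hcard
  have h5 : (S.card : ℝ) ≤ ((⌊b⌋ + 1 - ⌈a⌉).toNat : ℝ) := by exact_mod_cast hcard
  refine h5.trans ?_
  rcases le_total (⌊b⌋ + 1 - ⌈a⌉) 0 with h0 | h0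
  · rw [Int.toNat_of_nonpos h0]; push_cast; linarith
  · have : ((⌊b⌋ + 1 - ⌈a⌉).toNat : ℝ) = ((⌊b⌋ + 1 - ⌈a⌉ : ℤ) : ℝ) := by
      exact_mod_cast Int.toNat_of_nonneg h0
    rw [this]
    push_cast
    have := Int.floor_le b
    have := Int.le_ceil a
    linarith

lemma sum_latticeGap_sq_le {m : ℕ} (hm : 0 < m) (x y : ℝ) :
    ∑ t ∈ Finset.range m, latticeGap m (x + t) (y + t) ^ 2 ≤ 4 * (x - y) ^ 2 := by
  classical
  set S := (Finset.range m).filter fun t : ℕ => latticeGap m (x + t) (y + t) ≠ 0 with hS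
  have hcard : (S.card : ℝ) ≤ |x - y| + 3 := by
    have := card_shifts_le (m := m) S (Finset.filter_subset _ _) (a := min x y - 1)
      (b := max x y + 1) (by linarith [min_le_max (a := x) (b := y)]) (by
        intro t ht
        obtain ⟨n, h1, h2⟩ := exists_lattice_near_of_latticeGap_ne_zero hm
          (Finset.mem_filter.1 ht).2
        rw [min_add_add_right] at h1
        rw [max_add_add_right] at h2
        exact ⟨n, by linarith, by linarith⟩)
    have h2 := max_sub_min_eq_abs x y
    rw [abs_sub_comm] at h2
    linarith
  have hsum : ∑ t ∈ Finset.range m, latticeGap m (x + t) (y + t) ^ 2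
      = ∑ t ∈ S, latticeGap m (x + t) (y + t) ^ 2 := by
    rw [hS, Finset.sum_filter]
    refine Finset.sum_congr rfl fun t _ => ?_
    split_ifs with h
    · rfl
    · push Not at h
      rw [h]; ring
  have hb : ∀ t ∈ S, latticeGap m (x + t) (y + t) ^ 2 ≤ (min 1 |x - y|) ^ 2 := by
    intro t _
    have h1 := latticeGap_nonneg hm (x + t) (y + t)
    have h2 := latticeGap_le_one hm (x + t) (y + t)
    have h3 := latticeGap_le_abs_sub hm (x + t) (y + t)
    rw [add_sub_add_right_eq_sub] at h3
    exact pow_le_pow_left₀ h1 (le_min h2 h3) 2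
  rw [hsum]
  refine (Finset.sum_le_card_nsmul _ _ _ hb).trans ?_
  rw [nsmul_eq_mul, ← sq_abs (x - y)]
  have h0 := abs_nonneg (x - y)
  rcases le_total 1 |x - y| with h | h
  · rw [min_eq_left h]; nlinarith
  · rw [min_eq_right h]; nlinarith [sq_nonneg |x - y|]

lemma card_latticeDist_lt_one_le {m : ℕ} (hm : 0 < m) (x : ℝ) :
    (((Finset.range m).filter fun t : ℕ => latticeDist m (x + t) < 1).card : ℝ) ≤ 3 := by
  have := card_shifts_le (m := m) _ (Finset.filter_subset
    (fun t : ℕ => latticeDist m (x + t) < 1) _) (a := x - 1)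
      (b := x + 1) (by linarith) (by
        intro t ht
        obtain ⟨n, h1, h2⟩ := exists_lattice_near_of_latticeDist_lt_one hm
          (Finset.mem_filter.1 ht).2
        exact ⟨n, by linarith, by linarith⟩)
  linarith

/-- If weights are at most `b`, any finset of total weight at least `b / 2` contains
a part of weight between `b / 2` and `b`. -/
lemma exists_subset_sum_between {ι : Type*} [DecidableEq ι] (w : ι → ℝ) {b : ℝ}
    (hb0 : 0 ≤ b) (hb : ∀ i, w i ≤ b) (T : Finset ι) (hT : b / 2 ≤ ∑ i ∈ T, w i) :
    ∃ U ⊆ T, b / 2 ≤ ∑ i ∈ U, w i ∧ ∑ i ∈ U, w i ≤ b := by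
  induction T using Finset.strongInduction with
  | H T ih =>
    by_cases hle : ∑ i ∈ T, w i ≤ b
    · exact ⟨T, subset_rfl, hT, hle⟩
    push Not at hle
    by_cases hx : ∃ x ∈ T, b / 2 ≤ w x
    · obtain ⟨x, hxT, hx⟩ := hx
      exact ⟨{x}, by simpa using hxT, by simpa using hx, by simpa using hb x⟩
    push Not at hx
    obtain ⟨x, hxT⟩ : T.Nonempty := by
      rw [Finset.nonempty_iff_ne_empty]
      rintro rfl
      simp at hle hT
      linarith
    have h1 := Finset.sum_erase_add T w hxT
    obtain ⟨U, hU, h2⟩ := ih (T.erase x) (Finset.erase_ssubset hxT) (by linarith [hx x hxT])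
    exact ⟨U, hU.trans (Finset.erase_subset _ _), h2⟩

/-- Weights bounded by `b` with large total weight can be grouped into `n` disjoint
groups of weight at least `b / 2` each. -/
lemma exists_groups {ι : Type*} [DecidableEq ι] (w : ι → ℝ) {b : ℝ} (hb0 : 0 ≤ b)
    (hb : ∀ i, w i ≤ b) (n : ℕ) (T : Finset ι) (hT : n * b - b / 2 ≤ ∑ i ∈ T, w i) :
    ∃ P : Fin n → Finset ι, (∀ i, P i ⊆ T) ∧ (∀ i j, i ≠ j → Disjoint (P i) (P j)) ∧
      ∀ i, b / 2 ≤ ∑ c ∈ P i, w c := by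
  induction n generalizing T with
  | zero => exact ⟨fun _ => ∅, fun i => i.elim0, fun i => i.elim0, fun i => i.elim0⟩
  | succ n ih =>
    push_cast at hT
    have hn : (0 : ℝ) ≤ n * b := by positivity
    obtain ⟨U, hU, h1, h2⟩ := exists_subset_sum_between w hb0 hb T (by linarith)
    have h3 := Finset.sum_sdiff (f := w) hU
    obtain ⟨P, hP, hd, hs⟩ := ih (T \ U) (by linarith)
    have hPU : ∀ i, Disjoint U (P i) := fun i =>
      Finset.disjoint_left.2 fun x hx hx' => (Finset.mem_sdiff.1 (hP i hx')).2 hx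
    refine ⟨Fin.cons U P, ?_, ?_, ?_⟩
    · intro i
      refine Fin.cases ?_ (fun i => ?_) i
      · simpa using hU
      · simpa using (hP i).trans Finset.sdiff_subset
    · intro i j hij
      induction i using Fin.cases with
      | zero =>
        induction j using Fin.cases with
        | zero => exact absurd rfl hij
        | succ j => simpa using hPU j
      | succ i =>
        induction j using Fin.cases with
        | zero => simpa using (hPU i).symm
        | succ j => simpa using hd i j (fun h => hij (by rw [h]))
    · intro i
      refine Fin.cases ?_ (fun i => ?_) i
      · simpa using h1
      · simpa using hs i

lemma exists_le_two_mul_and_le_two_mul {ι : Type*} {T : Finset ι} (hT : T.Nonempty)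
    (f g : ι → ℝ) (hf : ∀ t ∈ T, 0 ≤ f t) (hg : ∀ t ∈ T, 0 ≤ g t) {A B : ℝ}
    (hA : 0 < A) (hB : 0 ≤ B)
    (hfA : ∑ t ∈ T, f t ≤ T.card * A) (hgB : ∑ t ∈ T, g t ≤ T.card * B) :
    ∃ t ∈ T, f t ≤ 2 * A ∧ g t ≤ 2 * B := by
  rcases hB.eq_or_lt with rfl | hB
  · obtain ⟨t, ht, h⟩ := Finset.exists_le_of_sum_le (f := f) (g := fun _ => A) hT
      (by simpa using hfA)
    have h0 := (Finset.single_le_sum hg ht).trans hgB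
    exact ⟨t, ht, by linarith, by simpa using h0⟩
  · obtain ⟨t, ht, h⟩ := Finset.exists_le_of_sum_le (f := fun t => f t / A + g t / B)
      (g := fun _ => (2 : ℝ)) hT (by
        rw [Finset.sum_add_distrib, ← Finset.sum_div, ← Finset.sum_div]
        have h1 : (∑ t ∈ T, f t) / A ≤ T.card := by rwa [div_le_iff₀ hA]
        have h2 : (∑ t ∈ T, g t) / B ≤ T.card := by rwa [div_le_iff₀ hB]
        simp only [Finset.sum_const, nsmul_eq_mul]
        linarith)
    have h1 := div_nonneg (hf t ht) hA.le
    have h2 := div_nonneg (hg t ht) hB.le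
    refine ⟨t, ht, ?_, ?_⟩
    · rw [← div_le_iff₀ hA]; linarith
    · rw [← div_le_iff₀ hB]; linarith

/-- Layer-cake principle: a combination of indicators of the layers `{t | t ≤ c j}` that is
nonnegative at every positive level stays nonnegative after replacing the indicators by `c j`. -/
lemma sum_mul_nonneg_of_layers {ι : Type*} (T : Finset ι) (a c : ι → ℝ) (hc : ∀ j ∈ T, 0 ≤ c j)
    (h : ∀ t : ℝ, 0 < t → 0 ≤ ∑ j ∈ T, a j * (if t ≤ c j then 1 else 0)) :
    0 ≤ ∑ j ∈ T, a j * c j := by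
  classical
  have key : ∀ j ∈ T, MeasureTheory.IntegrableOn (fun t : ℝ => if t ≤ c j then (1 : ℝ) else 0)
      (Set.Ioi 0) ∧ ∫ t in Set.Ioi (0 : ℝ), (if t ≤ c j then (1 : ℝ) else 0) = c j := by
    intro j hj
    have e : (fun t : ℝ => if t ≤ c j then (1 : ℝ) else 0)
        = Set.indicator (Set.Iic (c j)) (fun _ => (1 : ℝ)) := by
      ext t; simp [Set.indicator_apply]
    have e2 : Set.Ioi 0 ∩ Set.Iic (c j) = Set.Ioc 0 (c j) := Set.Ioi_inter_Iic
    constructor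
    · rw [e, MeasureTheory.IntegrableOn, MeasureTheory.integrable_indicator_iff measurableSet_Iic,
        MeasureTheory.IntegrableOn, MeasureTheory.Measure.restrict_restrict measurableSet_Iic,
        Set.inter_comm, e2]
      exact MeasureTheory.integrableOn_const (by simp)
    · rw [e, MeasureTheory.setIntegral_indicator measurableSet_Iic, e2]
      simp [hc j hj]
  have : ∑ j ∈ T, a j * c j
      = ∫ t in Set.Ioi (0 : ℝ), ∑ j ∈ T, a j * (if t ≤ c j then 1 else 0) := by
    rw [MeasureTheory.integral_finsetSum _ fun j hj => (key j hj).1.const_mul _]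
    refine Finset.sum_congr rfl fun j hj => ?_
    rw [MeasureTheory.integral_const_mul, (key j hj).2]
  rw [this]
  exact MeasureTheory.setIntegral_nonneg measurableSet_Ioi fun t ht => h t ht

section Cells

variable {ι : Type*}

/-- The cell of the shifted cubical lattice of mesh `m` that contains `Y`. -/
noncomputable def latticeCell (m : ℕ) (t : ι → ℕ) (Y : ι → ℝ) : ι → ℤ := fun i => ⌊(Y i + t i) / m⌋

/-- The unordered pair of the cells of `Y` and `-Y`, a label invariant under `Y ↦ -Y`. -/
noncomputable def signedCell (m : ℕ) (t : ι → ℕ) (Y : ι → ℝ) : Sym2 (ι → ℤ) :=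
  s(latticeCell m t Y, latticeCell m t (-Y))

lemma signedCell_neg (m : ℕ) (t : ι → ℕ) (Y : ι → ℝ) :
    signedCell m t (-Y) = signedCell m t Y := by
  rw [signedCell, signedCell, neg_neg, Sym2.eq_swap]

lemma abs_sub_le_of_latticeCell_eq {m : ℕ} (hm : 0 < m) {t : ι → ℕ} {Y Z : ι → ℝ}
    (h : latticeCell m t Y = latticeCell m t Z) (i : ι) : |Y i - Z i| ≤ m := by
  have h1 : ⌊(Y i + t i) / m⌋ = ⌊(Z i + t i) / m⌋ := congrFun h i
  have h2 := floor_div_mul_le hm (Y i + t i)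
  have h3 := lt_mul_floor_div_add_one hm (Y i + t i)
  have h4 := floor_div_mul_le hm (Z i + t i)
  have h5 := lt_mul_floor_div_add_one hm (Z i + t i)
  rw [h1] at h2 h3
  rw [abs_le]
  constructor <;> linarith

lemma abs_le_of_signedCell_eq {m : ℕ} (hm : 0 < m) {t : ι → ℕ} {Y Z : ι → ℝ}
    (h : signedCell m t Y = signedCell m t Z) :
    (∀ i, |Y i - Z i| ≤ m) ∨ ∀ i, |Y i + Z i| ≤ m := by
  rcases Sym2.eq_iff.1 h with ⟨h, -⟩ | ⟨h, -⟩
  · exact Or.inl (abs_sub_le_of_latticeCell_eq hm h)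
  · refine Or.inr fun i => ?_
    have := abs_sub_le_of_latticeCell_eq hm h i
    rwa [Pi.neg_apply, sub_neg_eq_add] at this

variable [Fintype ι] [Nonempty ι]

/-- The truncated distance from `Y` and `-Y` to the walls of the shifted cubical lattice. -/
noncomputable def wallDist (m : ℕ) (t : ι → ℕ) (Y : ι → ℝ) : ℝ :=
  Finset.univ.inf' Finset.univ_nonempty fun i =>
    min (latticeDist m (Y i + t i)) (latticeDist m (-Y i + t i))

lemma wallDist_neg (m : ℕ) (t : ι → ℕ) (Y : ι → ℝ) : wallDist m t (-Y) = wallDist m t Y := by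
  simp only [wallDist, Pi.neg_apply, neg_neg, min_comm]

lemma wallDist_nonneg {m : ℕ} (hm : 0 < m) (t : ι → ℕ) (Y : ι → ℝ) : 0 ≤ wallDist m t Y :=
  Finset.le_inf' _ _ fun _ _ => le_min (latticeDist_nonneg hm _) (latticeDist_nonneg hm _)

lemma wallDist_le (m : ℕ) (t : ι → ℕ) (Y : ι → ℝ) (i : ι) :
    wallDist m t Y ≤ min (latticeDist m (Y i + t i)) (latticeDist m (-Y i + t i)) :=
  Finset.inf'_le _ (Finset.mem_univ i)

lemma wallDist_le_one (m : ℕ) (t : ι → ℕ) (Y : ι → ℝ) : wallDist m t Y ≤ 1 :=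
  (wallDist_le m t Y (Classical.arbitrary ι)).trans ((min_le_left _ _).trans
    (latticeDist_le_one _ _))

lemma exists_wallDist_eq (m : ℕ) (t : ι → ℕ) (Y : ι → ℝ) :
    ∃ i, wallDist m t Y = min (latticeDist m (Y i + t i)) (latticeDist m (-Y i + t i)) := by
  obtain ⟨i, -, h⟩ := Finset.exists_mem_eq_inf' (Finset.univ_nonempty (α := ι)) fun i =>
    min (latticeDist m (Y i + t i)) (latticeDist m (-Y i + t i))
  exact ⟨i, h⟩

open Classical in
/-- The cutoff to a union `S` of signed cells that vanishes on the walls. -/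
noncomputable def cellCutoff (m : ℕ) (t : ι → ℕ) (S : Finset (Sym2 (ι → ℤ))) (Y : ι → ℝ) : ℝ :=
  if signedCell m t Y ∈ S then wallDist m t Y else 0

lemma cellCutoff_neg (m : ℕ) (t : ι → ℕ) (S : Finset (Sym2 (ι → ℤ))) (Y : ι → ℝ) :
    cellCutoff m t S (-Y) = cellCutoff m t S Y := by
  rw [cellCutoff, cellCutoff, signedCell_neg, wallDist_neg]

lemma cellCutoff_nonneg {m : ℕ} (hm : 0 < m) (t : ι → ℕ) (S : Finset (Sym2 (ι → ℤ)))
    (Y : ι → ℝ) : 0 ≤ cellCutoff m t S Y := by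
  unfold cellCutoff
  split_ifs
  · exact wallDist_nonneg hm t Y
  · exact le_rfl

lemma cellCutoff_le_wallDist {m : ℕ} (hm : 0 < m) (t : ι → ℕ) (S : Finset (Sym2 (ι → ℤ)))
    (Y : ι → ℝ) : cellCutoff m t S Y ≤ wallDist m t Y := by
  unfold cellCutoff
  split_ifs
  · exact le_rfl
  · exact wallDist_nonneg hm t Y

lemma sq_sub_wallDist_le {m : ℕ} (t : ι → ℕ) {Y Z : ι → ℝ}
    (h1 : latticeCell m t Y = latticeCell m t Z)
    (h2 : latticeCell m t (-Y) = latticeCell m t (-Z)) :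
    (wallDist m t Y - wallDist m t Z) ^ 2 ≤ ∑ i, (latticeGap m (Y i + t i) (Z i + t i) ^ 2 +
      latticeGap m (-Y i + t i) (-Z i + t i) ^ 2) := by
  wlog hle : wallDist m t Y ≤ wallDist m t Z generalizing Y Z
  · have := this h1.symm h2.symm (le_of_not_ge hle)
    rw [← neg_sub, neg_sq]
    refine this.trans (le_of_eq (Finset.sum_congr rfl fun i _ => ?_))
    have e : ∀ x y, latticeGap m x y = latticeGap m y x := by
      intro x y
      simp only [latticeGap, eq_comm, abs_sub_comm, max_comm]
    rw [e (Z i + t i), e (-Z i + t i)]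
  obtain ⟨i, hi⟩ := exists_wallDist_eq m t Y
  have h3 := wallDist_le m t Z i
  refine le_trans ?_ (Finset.single_le_sum (fun i _ => by positivity) (Finset.mem_univ i))
  have g1 : latticeGap m (Y i + t i) (Z i + t i)
      = |latticeDist m (Y i + t i) - latticeDist m (Z i + t i)| := if_pos (congrFun h1 i)
  have g2 : latticeGap m (-Y i + t i) (-Z i + t i)
      = |latticeDist m (-Y i + t i) - latticeDist m (-Z i + t i)| := if_pos (congrFun h2 i)
  rw [g1, g2]
  have h4 := abs_min_sub_min_le_max (latticeDist m (Y i + t i)) (latticeDist m (-Y i + t i))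
    (latticeDist m (Z i + t i)) (latticeDist m (-Z i + t i))
  rw [abs_sub_comm] at h4
  have h5 : wallDist m t Z - wallDist m t Y
      ≤ max |latticeDist m (Y i + t i) - latticeDist m (Z i + t i)|
        |latticeDist m (-Y i + t i) - latticeDist m (-Z i + t i)| := by
    refine le_trans ?_ ((le_abs_self _).trans h4)
    rw [hi]
    linarith
  have h6 : 0 ≤ wallDist m t Z - wallDist m t Y := by linarith
  have h7 := pow_le_pow_left₀ h6 h5 2
  rw [← neg_sub, neg_sq]
  refine h7.trans ?_
  rcases max_choice |latticeDist m (Y i + t i) - latticeDist m (Z i + t i)|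
    |latticeDist m (-Y i + t i) - latticeDist m (-Z i + t i)| with h | h <;> rw [h] <;> simp
  · positivity
  · positivity

lemma sq_sub_cellCutoff_le {m : ℕ} (hm : 0 < m) (t : ι → ℕ) (S : Finset (Sym2 (ι → ℤ)))
    (Y Z : ι → ℝ) :
    (cellCutoff m t S Y - cellCutoff m t S Z) ^ 2
      ≤ ∑ i, (latticeGap m (Y i + t i) (Z i + t i) ^ 2 +
        latticeGap m (-Y i + t i) (-Z i + t i) ^ 2) := by
  have hY := cellCutoff_nonneg hm t S Y
  have hZ := cellCutoff_nonneg hm t S Z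
  have hY' := cellCutoff_le_wallDist hm t S Y
  have hZ' := cellCutoff_le_wallDist hm t S Z
  have key : ∀ a b : ℝ, cellCutoff m t S Y ≤ a → cellCutoff m t S Z ≤ b →
      (cellCutoff m t S Y - cellCutoff m t S Z) ^ 2 ≤ max a b ^ 2 := by
    intro a b ha hb
    rw [← sq_abs]
    refine pow_le_pow_left₀ (abs_nonneg _) (abs_le.2 ⟨?_, ?_⟩) 2
    · linarith [le_max_right a b]
    · linarith [le_max_left a b]
  by_cases h1 : latticeCell m t Y = latticeCell m t Z
  · by_cases h2 : latticeCell m t (-Y) = latticeCell m t (-Z)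
    · have h3 : signedCell m t Y = signedCell m t Z := by rw [signedCell, signedCell, h1, h2]
      refine le_trans ?_ (sq_sub_wallDist_le t h1 h2)
      unfold cellCutoff
      rw [h3]
      split_ifs
      · exact le_rfl
      · rw [sub_zero, zero_pow two_ne_zero]; positivity
    · obtain ⟨i, hi⟩ := Function.ne_iff.1 h2
      refine le_trans ?_ (Finset.single_le_sum (fun i _ => by positivity) (Finset.mem_univ i))
      have g : latticeGap m (-Y i + t i) (-Z i + t i)
          = max (latticeDist m (-Y i + t i)) (latticeDist m (-Z i + t i)) := if_neg hi
      have := key _ _ (hY'.trans ((wallDist_le m t Y i).trans (min_le_right _ _)))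
        (hZ'.trans ((wallDist_le m t Z i).trans (min_le_right _ _)))
      rw [← g] at this
      exact this.trans (le_add_of_nonneg_left (sq_nonneg _))
  · obtain ⟨i, hi⟩ := Function.ne_iff.1 h1
    refine le_trans ?_ (Finset.single_le_sum (fun i _ => by positivity) (Finset.mem_univ i))
    have g : latticeGap m (Y i + t i) (Z i + t i)
        = max (latticeDist m (Y i + t i)) (latticeDist m (Z i + t i)) := if_neg hi
    have := key _ _ (hY'.trans ((wallDist_le m t Y i).trans (min_le_left _ _)))
      (hZ'.trans ((wallDist_le m t Z i).trans (min_le_left _ _)))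
    rw [← g] at this
    exact this.trans (le_add_of_nonneg_right (sq_nonneg _))

end Cells

section UnitVectors

variable {ι : Type*} [Fintype ι]

lemma one_sub_le_sq_inner_of_close {x y : ι → ℝ} (hx : ∑ i, x i ^ 2 = 1) (hy : ∑ i, y i ^ 2 = 1)
    {ε : ℝ} (h : ∑ i, (x i - y i) ^ 2 ≤ ε ∨ ∑ i, (x i + y i) ^ 2 ≤ ε) :
    1 - ε ≤ (∑ i, x i * y i) ^ 2 := by
  set p := ∑ i, x i * y i with hp
  have h1 : ∑ i, (x i - y i) ^ 2 = 2 - 2 * p := by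
    simp only [sub_sq, Finset.sum_add_distrib, Finset.sum_sub_distrib, hx, hy, mul_assoc,
      ← Finset.mul_sum, ← hp]
    ring
  have h2 : ∑ i, (x i + y i) ^ 2 = 2 + 2 * p := by
    simp only [add_sq, Finset.sum_add_distrib, hx, hy, mul_assoc, ← Finset.mul_sum, ← hp]
    ring
  rcases h with h | h
  · nlinarith [sq_nonneg (p - 1)]
  · nlinarith [sq_nonneg (p + 1)]

lemma sum_div_sqrt_sq {x : ι → ℝ} (hx : ∑ i, x i ^ 2 ≠ 0) :
    ∑ i, (x i / √(∑ l, x l ^ 2)) ^ 2 = 1 := by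
  have h : 0 ≤ ∑ l, x l ^ 2 := Finset.sum_nonneg fun _ _ => sq_nonneg _
  simp only [div_pow, Real.sq_sqrt h, ← Finset.sum_div]
  exact div_self hx

/-- Radial projection to the unit sphere is Lipschitz with the inverse of the smaller norm. -/
lemma min_mul_sum_sq_sub_normalized_le (x y : ι → ℝ) :
    min (∑ i, x i ^ 2) (∑ i, y i ^ 2) *
        ∑ i, (x i / √(∑ l, x l ^ 2) - y i / √(∑ l, y l ^ 2)) ^ 2
      ≤ ∑ i, (x i - y i) ^ 2 := by
  have hqx : 0 ≤ ∑ l, x l ^ 2 := Finset.sum_nonneg fun _ _ => sq_nonneg _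
  have hqy : 0 ≤ ∑ l, y l ^ 2 := Finset.sum_nonneg fun _ _ => sq_nonneg _
  have hR : 0 ≤ ∑ i, (x i - y i) ^ 2 := Finset.sum_nonneg fun _ _ => sq_nonneg _
  by_cases hx : ∑ l, x l ^ 2 = 0
  · rw [hx, min_eq_left hqy, zero_mul]; exact hR
  by_cases hy : ∑ l, y l ^ 2 = 0
  · rw [hy, min_eq_right hqx, zero_mul]; exact hR
  have hx1 := sum_div_sqrt_sq hx
  have hy1 := sum_div_sqrt_sq hy
  have ha2 := Real.sq_sqrt hqx
  have hb2 := Real.sq_sqrt hqy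
  set a := √(∑ l, x l ^ 2)
  set b := √(∑ l, y l ^ 2)
  have ha : 0 < a := Real.sqrt_pos.2 (lt_of_le_of_ne hqx (Ne.symm hx))
  have hb : 0 < b := Real.sqrt_pos.2 (lt_of_le_of_ne hqy (Ne.symm hy))
  set p := ∑ i, (x i / a) * (y i / b) with hp
  have h1 : ∑ i, (x i / a - y i / b) ^ 2 = 2 - 2 * p := by
    simp only [sub_sq, Finset.sum_add_distrib, Finset.sum_sub_distrib, hx1, hy1, mul_assoc,
      ← Finset.mul_sum, ← hp]
    ring
  have h2 : ∑ i, (x i - y i) ^ 2 = a ^ 2 + b ^ 2 - 2 * (a * b * p) := by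
    have e : a * b * p = ∑ i, x i * y i := by
      rw [hp, Finset.mul_sum]
      refine Finset.sum_congr rfl fun i _ => ?_
      field_simp
    rw [e, ha2, hb2]
    simp only [sub_sq, Finset.sum_add_distrib, Finset.sum_sub_distrib, mul_assoc,
      ← Finset.mul_sum]
    ring
  have h3 : 0 ≤ 2 - 2 * p := by
    rw [← h1]; exact Finset.sum_nonneg fun _ _ => sq_nonneg _
  have h4 : min (∑ l, x l ^ 2) (∑ l, y l ^ 2) ≤ a * b := by
    rw [← ha2, ← hb2]
    rcases le_total a b with h | h
    · exact (min_le_left _ _).trans (by nlinarith)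
    · exact (min_le_right _ _).trans (by nlinarith)
  rw [h1, h2]
  nlinarith [mul_le_mul_of_nonneg_right h4 h3, sq_nonneg (a - b)]

lemma sum_sq_sub_smul_le (x y : ι → ℝ) {a b : ℝ} (ha0 : 0 ≤ a) (ha1 : a ≤ 1) (hb0 : 0 ≤ b)
    (hb1 : b ≤ 1) :
    ∑ i, (a * x i - b * y i) ^ 2 ≤ 2 * (min (∑ i, x i ^ 2) (∑ i, y i ^ 2) * (a - b) ^ 2)
      + 2 * ∑ i, (x i - y i) ^ 2 := by
  rcases le_total (∑ i, x i ^ 2) (∑ i, y i ^ 2) with h | h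
  · rw [min_eq_left h, Finset.sum_mul, Finset.mul_sum, Finset.mul_sum, ← Finset.sum_add_distrib]
    refine Finset.sum_le_sum fun i _ => ?_
    nlinarith [sq_nonneg ((a - b) * x i - b * (x i - y i)),
      mul_nonneg (sq_nonneg (x i - y i)) (by nlinarith : 0 ≤ 1 - b ^ 2)]
  · rw [min_eq_right h, Finset.sum_mul, Finset.mul_sum, Finset.mul_sum, ← Finset.sum_add_distrib]
    refine Finset.sum_le_sum fun i _ => ?_
    nlinarith [sq_nonneg ((a - b) * y i - a * (x i - y i)),
      mul_nonneg (sq_nonneg (x i - y i)) (by nlinarith : 0 ≤ 1 - a ^ 2)]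

end UnitVectors

lemma exists_pos_and_le_mul {ι : Type*} (T : Finset ι) (E M : ι → ℝ) {Q : ℝ}
    (hE : ∀ i ∈ T, 0 ≤ E i) (hM : ∀ i ∈ T, 0 ≤ M i) (hpos : 0 < ∑ i ∈ T, M i)
    (h : ∑ i ∈ T, E i ≤ Q * ∑ i ∈ T, M i) : ∃ i ∈ T, 0 < M i ∧ E i ≤ Q * M i := by
  by_contra! hc
  obtain ⟨i, hi, hi0⟩ := Finset.exists_lt_of_sum_lt (f := fun _ => (0 : ℝ)) (by simpa using hpos)
  refine absurd h (not_le.2 ?_)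
  rw [Finset.mul_sum]
  refine Finset.sum_lt_sum (fun l hl => ?_) ⟨i, hi, hc i hi hi0⟩
  rcases (hM l hl).eq_or_lt with h0 | h0
  · rw [← h0, mul_zero]; exact hE l hl
  · exact (hc l hl h0).le

/-- The ordered pairs of adjacent vertices. -/
def adjPairs {V : Type*} [Fintype V] (G : SimpleGraph V) [DecidableRel G.Adj] : Finset (V × V) :=
  Finset.univ.filter fun p => G.Adj p.1 p.2

/-- The Dirichlet form of the signed graph, summed over ordered pairs of adjacent vertices. -/
noncomputable def signedEnergy {V : Type*} [Fintype V] (G : SimpleGraph V) [DecidableRel G.Adj]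
    (s : V → V → ℝ) (f : V → ℝ) : ℝ :=
  ∑ p ∈ adjPairs G, (f p.1 - s p.1 p.2 * f p.2) ^ 2

/-- The contribution of an ordered pair of adjacent vertices to the numerator of `signedBeta`. -/
noncomputable def cutWeight {V : Type*} [DecidableEq V] (s : V → V → ℝ) (A B : Finset V)
    (u v : V) : ℝ :=
  (if (u ∈ A ∧ v ∈ A) ∧ s u v = -1 then 1 else 0) +
    (if (u ∈ B ∧ v ∈ B) ∧ s u v = -1 then 1 else 0) +
    (if (u ∈ A ∧ v ∈ B) ∧ s u v = 1 then 1 else 0) +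
    (if (u ∈ B ∧ v ∈ A) ∧ s u v = 1 then 1 else 0) +
    (if u ∈ A ∪ B ∧ v ∉ A ∪ B then 1 else 0)

section SignedGraph

variable {V : Type*} [Fintype V] (G : SimpleGraph V) [DecidableRel G.Adj]

lemma mem_adjPairs {p : V × V} : p ∈ adjPairs G ↔ G.Adj p.1 p.2 := by simp [adjPairs]

lemma sum_adjPairs (φ : V → V → ℝ) :
    ∑ p ∈ adjPairs G, φ p.1 p.2 = ∑ u, ∑ v, if G.Adj u v then φ u v else 0 := by
  rw [adjPairs, Finset.sum_filter, Fintype.sum_prod_type]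

lemma sum_adjPairs_swap (φ : V → V → ℝ) :
    ∑ p ∈ adjPairs G, φ p.2 p.1 = ∑ p ∈ adjPairs G, φ p.1 p.2 := by
  rw [sum_adjPairs G φ, sum_adjPairs G fun u v => φ v u, Finset.sum_comm]
  simp only [G.adj_comm]

lemma sum_adjPairs_fst (c : V → ℝ) :
    ∑ p ∈ adjPairs G, c p.1 = ∑ v, (G.degree v : ℝ) * c v := by
  rw [sum_adjPairs G fun u _ => c u]
  refine Finset.sum_congr rfl fun u _ => ?_
  rw [← Finset.sum_filter, Finset.sum_const, nsmul_eq_mul,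
    ← SimpleGraph.card_neighborFinset_eq_degree,
    SimpleGraph.neighborFinset_eq_filter]

lemma sum_adjPairs_snd (c : V → ℝ) :
    ∑ p ∈ adjPairs G, c p.2 = ∑ v, (G.degree v : ℝ) * c v := by
  rw [← sum_adjPairs_fst, sum_adjPairs_swap G fun u _ => c u]

variable {G} {s : V → V → ℝ}

lemma signedEnergy_nonneg (f : V → ℝ) : 0 ≤ signedEnergy G s f :=
  Finset.sum_nonneg fun _ _ => sq_nonneg _

lemma signedEnergy_eq (hdeg : ∀ v, 0 < G.degree v)
    (hs : ∀ u v, G.Adj u v → s u v = 1 ∨ s u v = -1) (f : V → ℝ) :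
    signedEnergy G s f = 2 * ∑ v, (G.degree v : ℝ) * f v * slap G s f v := by
  have h1 : signedEnergy G s f = ∑ p ∈ adjPairs G, f p.1 ^ 2 + ∑ p ∈ adjPairs G, f p.2 ^ 2
      - 2 * ∑ p ∈ adjPairs G, s p.1 p.2 * f p.1 * f p.2 := by
    rw [signedEnergy, Finset.mul_sum, ← Finset.sum_add_distrib, ← Finset.sum_sub_distrib]
    refine Finset.sum_congr rfl fun p hp => ?_
    rcases hs _ _ ((mem_adjPairs G).1 hp) with h | h <;> rw [h] <;> ring
  rw [h1, sum_adjPairs_fst G fun v => f v ^ 2, sum_adjPairs_snd G fun v => f v ^ 2,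
    sum_adjPairs G fun u v => s u v * f u * f v, ← two_mul, ← mul_sub, ← Finset.sum_sub_distrib]
  congr 1
  refine Finset.sum_congr rfl fun u _ => ?_
  have hd : (G.degree u : ℝ) ≠ 0 := by exact_mod_cast (hdeg u).ne'
  rw [slap, SimpleGraph.neighborFinset_eq_filter, Finset.sum_filter]
  rw [mul_assoc, mul_sub, mul_sub, mul_div_assoc', mul_div_assoc', mul_div_cancel_left₀ _ hd,
    Finset.mul_sum]
  congr 1
  · ring
  · refine Finset.sum_congr rfl fun v _ => ?_
    split_ifs <;> ring

variable [DecidableEq V]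

lemma signedBeta_eq (hsym : ∀ u v, s u v = s v u) (A B : Finset V) :
    signedBeta G s A B = (∑ p ∈ adjPairs G, cutWeight s A B p.1 p.2) /
      ∑ v ∈ A ∪ B, (G.degree v : ℝ) := by
  rw [signedBeta]
  congr 1
  have key : ∀ (A B : Finset V) (P : V → V → Prop) [∀ u v, Decidable (P u v)],
      (∑ u ∈ A, ∑ v ∈ B, if G.Adj u v ∧ P u v then (1 : ℝ) else 0)
        = ∑ p ∈ adjPairs G, if (p.1 ∈ A ∧ p.2 ∈ B) ∧ P p.1 p.2 then (1 : ℝ) else 0 := by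
    intro A B P _
    have hmem : ∀ (A : Finset V) (f : V → ℝ), ∑ u ∈ A, f u = ∑ u, if u ∈ A then f u else 0 := by
      simp
    rw [sum_adjPairs G fun u v => if (u ∈ A ∧ v ∈ B) ∧ P u v then (1 : ℝ) else 0, hmem]
    refine Finset.sum_congr rfl fun u _ => ?_
    split_ifs with hu
    · rw [hmem]
      refine Finset.sum_congr rfl fun v _ => ?_
      by_cases hv : v ∈ B <;> by_cases h : G.Adj u v <;> simp [hu, hv, h]
    · simp [hu]
  have h3 : 2 * (∑ u ∈ A, ∑ v ∈ B, if G.Adj u v ∧ s u v = 1 then (1 : ℝ) else 0)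
      = (∑ p ∈ adjPairs G, if (p.1 ∈ A ∧ p.2 ∈ B) ∧ s p.1 p.2 = 1 then (1 : ℝ) else 0)
        + ∑ p ∈ adjPairs G, if (p.1 ∈ B ∧ p.2 ∈ A) ∧ s p.1 p.2 = 1 then (1 : ℝ) else 0 := by
    rw [two_mul, key A B fun u v => s u v = 1,
      ← sum_adjPairs_swap G fun u v => if (u ∈ B ∧ v ∈ A) ∧ s u v = 1 then (1 : ℝ) else 0]
    simp only [hsym, and_comm]
  have h4 := key (A ∪ B) (A ∪ B)ᶜ fun _ _ => True
  simp only [and_true] at h4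
  rw [key A A fun u v => s u v = -1, key B B fun u v => s u v = -1, h3, h4]
  simp only [cutWeight, Finset.sum_add_distrib, Finset.mem_compl]
  ring

omit [Fintype V] in
lemma cutWeight_nonneg (A B : Finset V) (u v : V) : 0 ≤ cutWeight s A B u v := by
  unfold cutWeight
  positivity

lemma signedBeta_nonneg (hsym : ∀ u v, s u v = s v u) (A B : Finset V) :
    0 ≤ signedBeta G s A B := by
  rw [signedBeta_eq hsym]
  exact div_nonneg (Finset.sum_nonneg fun _ _ => cutWeight_nonneg _ _ _ _)
    (Finset.sum_nonneg fun _ _ => Nat.cast_nonneg _)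

omit [DecidableEq V] in
lemma volume_pos (hdeg : ∀ v, 0 < G.degree v) {S : Finset V} (hS : S.Nonempty) :
    0 < ∑ v ∈ S, (G.degree v : ℝ) :=
  Finset.sum_pos (fun v _ => by exact_mod_cast hdeg v) hS

/-- The superlevel set `{f > 0, f² ≥ t}`. -/
noncomputable def posLevel (f : V → ℝ) (t : ℝ) : Finset V :=
  Finset.univ.filter fun v => 0 < f v ∧ t ≤ f v ^ 2

lemma cutWeight_posLevel (f : V → ℝ) {t : ℝ} (ht : 0 < t) {u v : V}
    (hs : s u v = 1 ∨ s u v = -1) :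
    cutWeight s (posLevel f t) (posLevel (-f) t) u v =
      (if t ≤ f u ^ 2 then 1 else 0) + ((if s u v * f u * f v < 0 then 1 else 0) - 1) *
        (if t ≤ min (f u ^ 2) (f v ^ 2) then 1 else 0) := by
  have hne : ∀ w, t ≤ f w ^ 2 → f w ≠ 0 := by
    intro w hw h0
    rw [h0] at hw
    norm_num at hw
    linarith
  unfold cutWeight posLevel
  simp only [Finset.mem_filter, Finset.mem_univ, true_and, Finset.mem_union, Pi.neg_apply, neg_sq,
    le_min_iff, Left.neg_pos_iff]
  by_cases hu : t ≤ f u ^ 2 <;> by_cases hv : t ≤ f v ^ 2 <;>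
    simp only [hu, hv, and_true, and_false,
    false_and, if_false, if_true]
  · rcases lt_or_gt_of_ne (hne u hu) with h1 | h1 <;>
      rcases lt_or_gt_of_ne (hne v hv) with h2 | h2 <;>
      rcases hs with h | h <;> rw [h] <;>
      simp [h1, h2, h1.not_gt, h2.not_gt, mul_pos_of_neg_of_neg, mul_neg_of_neg_of_pos,
        mul_neg_of_pos_of_neg] <;> norm_num <;> nlinarith
  · rcases lt_or_gt_of_ne (hne u hu) with h1 | h1 <;> simp [h1, h1.not_gt]
  · simp
  · simp

omit [DecidableEq V] in
lemma weightedNormSq_pos (hdeg : ∀ v, 0 < G.degree v) {f : V → ℝ} (hf : ∃ v, f v ≠ 0) :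
    0 < ∑ v, (G.degree v : ℝ) * f v ^ 2 := by
  obtain ⟨v, hv⟩ := hf
  refine Finset.sum_pos' (fun w _ => by positivity) ⟨v, Finset.mem_univ v, ?_⟩
  have : (0 : ℝ) < G.degree v := by exact_mod_cast hdeg v
  positivity

/-- The layer inequality behind `exists_pair_signedBeta_sq_le` for a pair of vertices, with
`y = s u v * f v`. -/
lemma layer_le_half_abs_mul (x y : ℝ) :
    (x ^ 2 + y ^ 2) / 2 + ((if x * y < 0 then 1 else 0) - 1) * min (x ^ 2) (y ^ 2)
      ≤ |x - y| * (|x| + |y|) / 2 := by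
  have key : |x - y| * (|x| + |y|) = if x * y < 0 then (|x| + |y|) ^ 2 else |x ^ 2 - y ^ 2| := by
    split_ifs with h
    · have : |x - y| = |x| + |y| := by
        rcases mul_neg_iff.1 h with ⟨h1, h2⟩ | ⟨h1, h2⟩
        · rw [abs_of_pos h1, abs_of_neg h2, abs_of_pos (by linarith)]; ring
        · rw [abs_of_neg h1, abs_of_pos h2, abs_of_neg (by linarith)]; ring
      rw [this]; ring
    · have : |x| + |y| = |x + y| := by
        rcases mul_nonneg_iff.1 (not_lt.1 h) with ⟨h1, h2⟩ | ⟨h1, h2⟩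
        · rw [abs_of_nonneg h1, abs_of_nonneg h2, abs_of_nonneg (by linarith)]
        · rw [abs_of_nonpos h1, abs_of_nonpos h2, abs_of_nonpos (by linarith)]; ring
      rw [this, ← abs_mul]; congr 1; ring
  rw [key]
  split_ifs with h
  · have := mul_nonneg (abs_nonneg x) (abs_nonneg y)
    nlinarith [sq_abs x, sq_abs y]
  · rcases le_total (x ^ 2) (y ^ 2) with h | h
    · rw [min_eq_left h, abs_of_nonpos (by linarith)]; linarith
    · rw [min_eq_right h, abs_of_nonneg (by linarith)]; linarith

/-- The Cheeger rounding of a function on a signed graph: some pair of subsets of the support of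
`f` has signed bipartiteness ratio controlled by the Rayleigh quotient of `f`. -/
lemma exists_pair_signedBeta_sq_le (hdeg : ∀ v, 0 < G.degree v)
    (hs : ∀ u v, G.Adj u v → s u v = 1 ∨ s u v = -1) (hsym : ∀ u v, s u v = s v u)
    (f : V → ℝ) (hf : ∃ v, f v ≠ 0) :
    ∃ A B : Finset V, Disjoint A B ∧ (A ∪ B).Nonempty ∧ (∀ v ∈ A ∪ B, f v ≠ 0) ∧
      signedBeta G s A B ^ 2 * ∑ v, (G.degree v : ℝ) * f v ^ 2 ≤ signedEnergy G s f := by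
  classical
  have hM := weightedNormSq_pos hdeg hf
  set M := ∑ v, (G.degree v : ℝ) * f v ^ 2 with hMdef
  let F : Finset (Finset V × Finset V) := Finset.univ.filter fun P =>
    Disjoint P.1 P.2 ∧ (P.1 ∪ P.2).Nonempty ∧ ∀ v ∈ P.1 ∪ P.2, f v ≠ 0
  have hlevel : ∀ t : ℝ, Disjoint (posLevel f t) (posLevel (-f) t) ∧
      ∀ v ∈ posLevel f t ∪ posLevel (-f) t, f v ≠ 0 := by
    intro t
    constructor
    · rw [Finset.disjoint_left]
      intro v h1 h2
      simp only [posLevel, Finset.mem_filter, Pi.neg_apply] at h1 h2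
      linarith [h1.2.1, h2.2.1]
    · intro v hv
      simp only [posLevel, Finset.mem_union, Finset.mem_filter, Pi.neg_apply] at hv
      rcases hv with h | h
      · exact h.2.1.ne'
      · intro h0
        linarith [h.2.1]
  have hunion : ∀ t : ℝ, 0 < t →
      posLevel f t ∪ posLevel (-f) t = Finset.univ.filter fun v => t ≤ f v ^ 2 := by
    intro t ht
    ext v
    simp only [posLevel, Finset.mem_union, Finset.mem_filter, Finset.mem_univ, true_and,
      Pi.neg_apply, neg_sq, ← or_and_right, and_iff_right_iff_imp, Left.neg_pos_iff]
    intro h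
    have : f v ≠ 0 := by
      intro h0
      rw [h0] at h
      norm_num at h
      linarith
    exact (lt_or_gt_of_ne this).symm
  have hFne : F.Nonempty := by
    obtain ⟨v, hv⟩ := hf
    refine ⟨(posLevel f (f v ^ 2), posLevel (-f) (f v ^ 2)), Finset.mem_filter.2
      ⟨Finset.mem_univ _, (hlevel _).1, ⟨v, ?_⟩, (hlevel _).2⟩⟩
    rw [hunion _ (by positivity)]
    simp
  obtain ⟨⟨A, B⟩, hAB, hmin⟩ := F.exists_min_image (fun P => signedBeta G s P.1 P.2) hFne
  obtain ⟨-, hd, hne, hsupp⟩ := Finset.mem_filter.1 hAB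
  refine ⟨A, B, hd, hne, hsupp, ?_⟩
  set h := signedBeta G s A B with hh
  have hh0 : 0 ≤ h := signedBeta_nonneg hsym _ _
  let bad : V × V → ℝ := fun p => if s p.1 p.2 * f p.1 * f p.2 < 0 then 1 else 0
  have hlayer := sum_mul_nonneg_of_layers (adjPairs G ×ˢ (Finset.univ : Finset Bool))
    (fun q => if q.2 then bad q.1 - 1 else 1 - h)
    (fun q => if q.2 then min (f q.1.1 ^ 2) (f q.1.2 ^ 2) else f q.1.1 ^ 2)
    (by
      intro q _
      split_ifs
      · exact le_min (sq_nonneg _) (sq_nonneg _)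
      · exact sq_nonneg _)
    (by
      intro t ht
      simp only [Finset.sum_product, Fintype.sum_bool, if_true, if_false, Bool.false_eq_true]
      have h1 : ∑ p ∈ adjPairs G, cutWeight s (posLevel f t) (posLevel (-f) t) p.1 p.2
          = ∑ p ∈ adjPairs G, ((if t ≤ f p.1 ^ 2 then 1 else 0) + (bad p - 1) *
            (if t ≤ min (f p.1 ^ 2) (f p.2 ^ 2) then 1 else 0)) :=
        Finset.sum_congr rfl fun p hp =>
          cutWeight_posLevel f ht (hs _ _ ((mem_adjPairs G).1 hp))
      have h2 : ∑ p ∈ adjPairs G, (if t ≤ f p.1 ^ 2 then (1 : ℝ) else 0)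
          = ∑ v ∈ posLevel f t ∪ posLevel (-f) t, (G.degree v : ℝ) := by
        rw [sum_adjPairs_fst G fun v => if t ≤ f v ^ 2 then (1 : ℝ) else 0, hunion t ht,
          Finset.sum_filter]
        simp
      have h3 : h * ∑ v ∈ posLevel f t ∪ posLevel (-f) t, (G.degree v : ℝ)
          ≤ ∑ p ∈ adjPairs G, cutWeight s (posLevel f t) (posLevel (-f) t) p.1 p.2 := by
        rcases (posLevel f t ∪ posLevel (-f) t).eq_empty_or_nonempty with he | hne
        · rw [he, Finset.sum_empty, mul_zero]
          exact Finset.sum_nonneg fun _ _ => cutWeight_nonneg _ _ _ _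
        · have := hmin (posLevel f t, posLevel (-f) t) (Finset.mem_filter.2
            ⟨Finset.mem_univ _, (hlevel t).1, hne, (hlevel t).2⟩)
          rw [signedBeta_eq hsym (posLevel f t), le_div_iff₀ (volume_pos hdeg hne)] at this
          exact this
      rw [h1, ← h2, Finset.sum_add_distrib] at h3
      rw [Finset.sum_add_distrib, ← Finset.mul_sum]
      linarith)
  simp only [Finset.sum_product, Fintype.sum_bool, if_true, if_false, Bool.false_eq_true,
    Finset.sum_add_distrib, ← Finset.mul_sum] at hlayer
  have hM1 : ∑ p ∈ adjPairs G, f p.1 ^ 2 = M := sum_adjPairs_fst G fun v => f v ^ 2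
  have hM2 : ∑ p ∈ adjPairs G, f p.2 ^ 2 = M := sum_adjPairs_snd G fun v => f v ^ 2
  have hle : ∑ p ∈ adjPairs G, ((f p.1 ^ 2 + f p.2 ^ 2) / 2 +
      (bad p - 1) * min (f p.1 ^ 2) (f p.2 ^ 2))
      ≤ ∑ p ∈ adjPairs G, |f p.1 - s p.1 p.2 * f p.2| * (|f p.1| + |f p.2|) / 2 := by
    refine Finset.sum_le_sum fun p hp => ?_
    have := layer_le_half_abs_mul (f p.1) (s p.1 p.2 * f p.2)
    have e : f p.1 * (s p.1 p.2 * f p.2) = s p.1 p.2 * f p.1 * f p.2 := by ring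
    rw [e] at this
    rcases hs _ _ ((mem_adjPairs G).1 hp) with h | h <;>
      simpa [bad, h] using this
  rw [Finset.sum_add_distrib, ← Finset.sum_div, ← Finset.sum_div, Finset.sum_add_distrib, hM1,
    hM2] at hle
  rw [hM1] at hlayer
  have hcs := Finset.sum_mul_sq_le_sq_mul_sq (adjPairs G)
    (fun p => |f p.1 - s p.1 p.2 * f p.2|) (fun p => |f p.1| + |f p.2|)
  have hE : ∑ p ∈ adjPairs G, |f p.1 - s p.1 p.2 * f p.2| ^ 2 = signedEnergy G s f := by
    simp only [sq_abs, signedEnergy]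
  have h4 : ∑ p ∈ adjPairs G, (|f p.1| + |f p.2|) ^ 2 ≤ 4 * M := by
    have : ∑ p ∈ adjPairs G, (2 * f p.1 ^ 2 + 2 * f p.2 ^ 2) = 4 * M := by
      rw [Finset.sum_add_distrib, ← Finset.mul_sum, ← Finset.mul_sum, hM1, hM2]; ring
    rw [← this]
    refine Finset.sum_le_sum fun p _ => ?_
    nlinarith [sq_abs (f p.1), sq_abs (f p.2), sq_nonneg (|f p.1| - |f p.2|)]
  rw [hE] at hcs
  set X := ∑ p ∈ adjPairs G, |f p.1 - s p.1 p.2 * f p.2| * (|f p.1| + |f p.2|)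
  have h5 : h * M ≤ X / 2 := by linarith
  have h6 : (h * M) ^ 2 ≤ (X / 2) ^ 2 := pow_le_pow_left₀ (by positivity) h5 2
  have h7 := mul_le_mul_of_nonneg_left h4 (signedEnergy_nonneg (G := G) (s := s) f)
  have h8 : h ^ 2 * M * M ≤ signedEnergy G s f * M := by nlinarith
  exact le_of_mul_le_mul_right h8 hM

section Spectral

variable {lam : Fin (Fintype.card V) → ℝ} {u : Fin (Fintype.card V) → V → ℝ}

omit [DecidableEq V] in
lemma exists_eigenbasis_expansion
    (hu : ∀ i j, (∑ v, (G.degree v : ℝ) * u i v * u j v) = if i = j then 1 else 0)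
    (f : V → ℝ) :
    ∃ c : Fin (Fintype.card V) → ℝ, (∀ v, f v = ∑ i, c i * u i v) ∧
      ∀ i, ∑ v, (G.degree v : ℝ) * f v * u i v = c i := by
  have hcoef : ∀ (c : Fin (Fintype.card V) → ℝ) (i),
      ∑ v, (G.degree v : ℝ) * (∑ j, c j * u j v) * u i v = c i := by
    intro c i
    calc ∑ v, (G.degree v : ℝ) * (∑ j, c j * u j v) * u i v
        = ∑ j, c j * ∑ v, (G.degree v : ℝ) * u j v * u i v := by
          simp only [Finset.mul_sum, Finset.sum_mul]
          rw [Finset.sum_comm]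
          refine Finset.sum_congr rfl fun j _ => Finset.sum_congr rfl fun v _ => by ring
      _ = c i := by simp [hu]
  have hli : LinearIndependent ℝ u := by
    rw [Fintype.linearIndependent_iff]
    intro c hc i
    rw [← hcoef c i]
    refine Finset.sum_eq_zero fun v _ => ?_
    have := congrFun hc v
    simp only [Finset.sum_apply, Pi.smul_apply, smul_eq_mul, Pi.zero_apply] at this
    rw [this]; ring
  have hspan := hli.span_eq_top_of_card_eq_finrank' (by simp)
  obtain ⟨c, hc⟩ := (Submodule.mem_span_range_iff_exists_fun ℝ).1
    (hspan ▸ Submodule.mem_top : f ∈ Submodule.span ℝ (Set.range u))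
  have hf : ∀ v, f v = ∑ i, c i * u i v := by
    intro v
    simp [← hc]
  refine ⟨c, hf, fun i => ?_⟩
  simp only [hf, hcoef]

omit [DecidableEq V] in
lemma slap_eigenbasis_expansion (hlam : ∀ i, slap G s (u i) = lam i • u i) {f : V → ℝ}
    {c : Fin (Fintype.card V) → ℝ} (hf : ∀ v, f v = ∑ i, c i * u i v) (v : V) :
    slap G s f v = ∑ i, c i * lam i * u i v := by
  have h : ∀ i, c i * lam i * u i v
      = c i * u i v - (∑ w ∈ G.neighborFinset v, s v w * (c i * u i w)) / (G.degree v : ℝ) := by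
    intro i
    have := congrFun (hlam i) v
    simp only [slap, Pi.smul_apply, smul_eq_mul] at this
    rw [mul_assoc, ← this, mul_sub, mul_div_assoc', Finset.mul_sum]
    congr 2
    exact Finset.sum_congr rfl fun w _ => by ring
  simp only [h, Finset.sum_sub_distrib, ← Finset.sum_div]
  rw [Finset.sum_comm]
  simp only [slap, hf, Finset.mul_sum]

omit [DecidableEq V] in
lemma signedEnergy_eigenvector (hdeg : ∀ v, 0 < G.degree v)
    (hs : ∀ u v, G.Adj u v → s u v = 1 ∨ s u v = -1)
    (hlam : ∀ i, slap G s (u i) = lam i • u i)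
    (hu : ∀ i j, (∑ v, (G.degree v : ℝ) * u i v * u j v) = if i = j then 1 else 0)
    (i : Fin (Fintype.card V)) : signedEnergy G s (u i) = 2 * lam i := by
  rw [signedEnergy_eq hdeg hs, hlam]
  have := hu i i
  simp only [if_true] at this
  calc 2 * ∑ v, (G.degree v : ℝ) * u i v * (lam i • u i) v
      = 2 * (lam i * ∑ v, (G.degree v : ℝ) * u i v * u i v) := by
        congr 1
        rw [Finset.mul_sum]
        exact Finset.sum_congr rfl fun v _ => by simp only [Pi.smul_apply, smul_eq_mul]; ring
    _ = 2 * lam i := by rw [this, mul_one]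

omit [DecidableEq V] in
/-- A function orthogonal to the eigenvectors of index below `l` has Rayleigh quotient at least
the eigenvalue of index `l`. -/
lemma two_mul_eigenvalue_mul_le_signedEnergy (hdeg : ∀ v, 0 < G.degree v)
    (hs : ∀ u v, G.Adj u v → s u v = 1 ∨ s u v = -1)
    (hmono : Monotone lam) (hlam : ∀ i, slap G s (u i) = lam i • u i)
    (hu : ∀ i j, (∑ v, (G.degree v : ℝ) * u i v * u j v) = if i = j then 1 else 0)
    (f : V → ℝ) (l : Fin (Fintype.card V))
    (hf : ∀ i < l, ∑ v, (G.degree v : ℝ) * f v * u i v = 0) :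
    2 * lam l * ∑ v, (G.degree v : ℝ) * f v ^ 2 ≤ signedEnergy G s f := by
  obtain ⟨c, hc, hci⟩ := exists_eigenbasis_expansion hu f
  have hM : ∑ v, (G.degree v : ℝ) * f v ^ 2 = ∑ i, c i ^ 2 := by
    calc ∑ v, (G.degree v : ℝ) * f v ^ 2
        = ∑ v, ∑ i, c i * ((G.degree v : ℝ) * f v * u i v) := by
          refine Finset.sum_congr rfl fun v _ => ?_
          rw [pow_two, ← mul_assoc]
          nth_rewrite 2 [hc v]
          rw [Finset.mul_sum]
          exact Finset.sum_congr rfl fun i _ => by ring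
      _ = ∑ i, c i ^ 2 := by
          rw [Finset.sum_comm]
          refine Finset.sum_congr rfl fun i _ => ?_
          rw [← Finset.mul_sum, hci, pow_two]
  have hE : signedEnergy G s f = 2 * ∑ i, lam i * c i ^ 2 := by
    rw [signedEnergy_eq hdeg hs]
    congr 1
    calc ∑ v, (G.degree v : ℝ) * f v * slap G s f v
        = ∑ v, ∑ i, c i * lam i * ((G.degree v : ℝ) * f v * u i v) := by
          refine Finset.sum_congr rfl fun v _ => ?_
          rw [slap_eigenbasis_expansion hlam hc, Finset.mul_sum]
          exact Finset.sum_congr rfl fun i _ => by ring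
      _ = ∑ i, lam i * c i ^ 2 := by
          rw [Finset.sum_comm]
          refine Finset.sum_congr rfl fun i _ => ?_
          rw [← Finset.mul_sum, hci]; ring
  rw [hM, hE, mul_assoc, Finset.mul_sum]
  refine mul_le_mul_of_nonneg_left (Finset.sum_le_sum fun i _ => ?_) zero_le_two
  rcases lt_or_ge i l with h | h
  · rw [← hci i, hf i h]; simp
  · exact mul_le_mul_of_nonneg_right (hmono h) (sq_nonneg _)

end Spectral

/-- The function `1` on `A`, `-1` on `B \ A` and `0` elsewhere. -/
noncomputable def pairSign (A B : Finset V) (v : V) : ℝ :=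
  if v ∈ A then 1 else if v ∈ B then -1 else 0

omit [Fintype V] in
lemma pairSign_sq (A B : Finset V) (v : V) :
    pairSign A B v ^ 2 = if v ∈ A ∪ B then 1 else 0 := by
  unfold pairSign
  by_cases h1 : v ∈ A <;> by_cases h2 : v ∈ B <;> simp [h1, h2]

omit [Fintype V] in
lemma pairSign_eq_zero {A B : Finset V} {v : V} (h : v ∉ A ∪ B) : pairSign A B v = 0 := by
  have := pairSign_sq A B v
  rw [if_neg h] at this
  exact pow_eq_zero_iff (two_ne_zero) |>.1 this

omit [Fintype V] in
lemma pairSign_sub_sq_le {A B : Finset V} (hd : Disjoint A B) {x y : V}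
    (hs : s x y = 1 ∨ s x y = -1) (hsym : s x y = s y x) (hx : x ∈ A ∪ B) (hy : y ∈ A ∪ B) :
    (pairSign A B x - s x y * pairSign A B y) ^ 2
      ≤ 2 * (cutWeight s A B x y + cutWeight s A B y x) := by
  have hmem : ∀ z ∈ A ∪ B, (z ∈ A ∧ z ∉ B) ∨ (z ∉ A ∧ z ∈ B) := fun z hz =>
    (Finset.mem_union.1 hz).imp (fun h => ⟨h, Finset.disjoint_left.1 hd h⟩)
      fun h => ⟨Finset.disjoint_right.1 hd h, h⟩
  unfold cutWeight pairSign
  rw [← hsym]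
  rcases hmem x hx with ⟨h1, h2⟩ | ⟨h1, h2⟩ <;> rcases hmem y hy with ⟨h3, h4⟩ | ⟨h3, h4⟩ <;>
    rcases hs with h | h <;> rw [h] <;> simp [h1, h2, h3, h4] <;> norm_num

omit [Fintype V] in
lemma one_le_cutWeight {A B : Finset V} {x y : V} (hx : x ∈ A ∪ B) (hy : y ∉ A ∪ B) :
    1 ≤ cutWeight s A B x y := by
  unfold cutWeight
  rw [if_pos (⟨hx, hy⟩ : x ∈ A ∪ B ∧ y ∉ A ∪ B), le_add_iff_nonneg_left]
  positivity

omit [Fintype V] in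
lemma sq_sum_mul_pairSign {ι : Type*} [Fintype ι] {P : ι → Finset V × Finset V}
    (hP : ∀ i i', i ≠ i' → Disjoint ((P i).1 ∪ (P i).2) ((P i').1 ∪ (P i').2)) (a : ι → ℝ) (v : V) :
    (∑ i, a i * pairSign (P i).1 (P i).2 v) ^ 2
      = ∑ i, a i ^ 2 * if v ∈ (P i).1 ∪ (P i).2 then 1 else 0 := by
  classical
  by_cases h : ∃ i, v ∈ (P i).1 ∪ (P i).2
  · obtain ⟨i, hi⟩ := h
    have hne : ∀ k, k ≠ i → v ∉ (P k).1 ∪ (P k).2 := fun k hk =>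
      Finset.disjoint_left.1 (hP i k hk.symm) hi
    rw [Finset.sum_eq_single i (fun k _ hk => by rw [pairSign_eq_zero (hne k hk), mul_zero])
      (by simp), Finset.sum_eq_single i (fun k _ hk => by rw [if_neg (hne k hk), mul_zero])
      (by simp), mul_pow, pairSign_sq]
  · push Not at h
    rw [Finset.sum_eq_zero fun k _ => by rw [pairSign_eq_zero (h k), mul_zero],
      Finset.sum_eq_zero fun k _ => by rw [if_neg (h k), mul_zero]]
    norm_num

omit [Fintype V] in
lemma sum_mul_pairSign_sub_sq_le {ι : Type*} [Fintype ι] {P : ι → Finset V × Finset V}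
    (hd : ∀ i, Disjoint (P i).1 (P i).2)
    (hP : ∀ i i', i ≠ i' → Disjoint ((P i).1 ∪ (P i).2) ((P i').1 ∪ (P i').2)) (a : ι → ℝ)
    {x y : V} (hs : s x y = 1 ∨ s x y = -1) (hsym : s x y = s y x) :
    (∑ i, a i * pairSign (P i).1 (P i).2 x - s x y * ∑ i, a i * pairSign (P i).1 (P i).2 y) ^ 2
      ≤ ∑ i, 2 * a i ^ 2 * (cutWeight s (P i).1 (P i).2 x y + cutWeight s (P i).1 (P i).2 y x) := by
  classical
  by_cases h : ∃ i, x ∈ (P i).1 ∪ (P i).2 ∧ y ∈ (P i).1 ∪ (P i).2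
  · obtain ⟨i, hx, hy⟩ := h
    rw [Finset.sum_eq_single i (fun k _ hk => by
        rw [pairSign_eq_zero (Finset.disjoint_left.1 (hP i k hk.symm) hx), mul_zero]) (by simp),
      Finset.sum_eq_single i (fun k _ hk => by
        rw [pairSign_eq_zero (Finset.disjoint_left.1 (hP i k hk.symm) hy), mul_zero]) (by simp)]
    refine le_trans ?_ (Finset.single_le_sum (fun k _ => mul_nonneg (by positivity)
      (add_nonneg (cutWeight_nonneg _ _ _ _) (cutWeight_nonneg _ _ _ _))) (Finset.mem_univ i))
    have := mul_le_mul_of_nonneg_left (pairSign_sub_sq_le (hd i) hs hsym hx hy) (sq_nonneg (a i))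
    linarith
  · push Not at h
    have key : ∀ z w, (∀ i, z ∈ (P i).1 ∪ (P i).2 → w ∉ (P i).1 ∪ (P i).2) →
        (∑ i, a i * pairSign (P i).1 (P i).2 z) ^ 2
          ≤ ∑ i, a i ^ 2 * cutWeight s (P i).1 (P i).2 z w := by
      intro z w hzw
      rw [sq_sum_mul_pairSign hP]
      refine Finset.sum_le_sum fun i _ => mul_le_mul_of_nonneg_left ?_ (sq_nonneg _)
      split_ifs with hz
      · exact one_le_cutWeight hz (hzw i hz)
      · exact cutWeight_nonneg _ _ _ _
    have h1 := key x y h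
    have h2 := key y x fun i hy hx => h i hx hy
    have h3 : ∑ i, 2 * a i ^ 2 * (cutWeight s (P i).1 (P i).2 x y + cutWeight s (P i).1 (P i).2 y x)
        = 2 * (∑ i, a i ^ 2 * cutWeight s (P i).1 (P i).2 x y)
          + 2 * ∑ i, a i ^ 2 * cutWeight s (P i).1 (P i).2 y x := by
      rw [Finset.mul_sum, Finset.mul_sum, ← Finset.sum_add_distrib]
      exact Finset.sum_congr rfl fun i _ => by ring
    rw [h3]
    set g := ∑ i, a i * pairSign (P i).1 (P i).2 x
    set g' := ∑ i, a i * pairSign (P i).1 (P i).2 y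
    rcases hs with h | h <;> rw [h] <;> nlinarith [sq_nonneg (g - g'), sq_nonneg (g + g')]

/-- The upper half of the higher-order Cheeger inequality: `j` disjoint pairs of signed
bipartiteness ratio at most `b` force the `j`-th eigenvalue below `2b`. -/
lemma eigenvalue_le_two_mul_of_signedBeta_le (hdeg : ∀ v, 0 < G.degree v)
    (hs : ∀ u v, G.Adj u v → s u v = 1 ∨ s u v = -1) (hsym : ∀ u v, s u v = s v u)
    {lam : Fin (Fintype.card V) → ℝ} {u : Fin (Fintype.card V) → V → ℝ}
    (hmono : Monotone lam) (hlam : ∀ i, slap G s (u i) = lam i • u i)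
    (hu : ∀ i j, (∑ v, (G.degree v : ℝ) * u i v * u j v) = if i = j then 1 else 0)
    {j : ℕ} (l : Fin (Fintype.card V)) (hl : (l : ℕ) < j) {P : Fin j → Finset V × Finset V}
    (hd : ∀ i, Disjoint (P i).1 (P i).2) (hne : ∀ i, ((P i).1 ∪ (P i).2).Nonempty)
    (hP : ∀ i i', i ≠ i' → Disjoint ((P i).1 ∪ (P i).2) ((P i').1 ∪ (P i').2)) {b : ℝ}
    (hb : ∀ i, signedBeta G s (P i).1 (P i).2 ≤ b) :
    lam l ≤ 2 * b := by
  let g : (Fin j → ℝ) →ₗ[ℝ] (V → ℝ) :=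
    Fintype.linearCombination ℝ fun i => pairSign (P i).1 (P i).2
  have hg : ∀ a v, g a v = ∑ i, a i * pairSign (P i).1 (P i).2 v := by
    intro a v
    simp [g, Fintype.linearCombination_apply]
  let T : (V → ℝ) →ₗ[ℝ] (Fin l → ℝ) :=
    { toFun := fun f i => ∑ v, (G.degree v : ℝ) * f v * u ⟨i, i.2.trans l.2⟩ v
      map_add' := fun f f' => by
        ext i
        simp only [Pi.add_apply, ← Finset.sum_add_distrib]
        exact Finset.sum_congr rfl fun v _ => by ring
      map_smul' := fun c f => by
        ext i
        simp only [Pi.smul_apply, smul_eq_mul, RingHom.id_apply, Finset.mul_sum]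
        exact Finset.sum_congr rfl fun v _ => by ring }
  obtain ⟨a, ha, ha0⟩ := Submodule.exists_mem_ne_zero_of_ne_bot
    (LinearMap.ker_ne_bot_of_finrank_lt (f := T ∘ₗ g) (by simpa using hl))
  have hort : ∀ i < l, ∑ v, (G.degree v : ℝ) * g a v * u i v = 0 := by
    intro i hi
    exact congrFun (LinearMap.mem_ker.1 ha) ⟨i, hi⟩
  have hlow := two_mul_eigenvalue_mul_le_signedEnergy hdeg hs hmono hlam hu (g a) l hort
  set vol : Fin j → ℝ := fun i => ∑ v ∈ (P i).1 ∪ (P i).2, (G.degree v : ℝ) with hvol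
  have hvpos : ∀ i, 0 < vol i := fun i => volume_pos hdeg (hne i)
  have hM : ∑ v, (G.degree v : ℝ) * g a v ^ 2 = ∑ i, a i ^ 2 * vol i := by
    simp only [hg, sq_sum_mul_pairSign hP, Finset.mul_sum]
    rw [Finset.sum_comm]
    refine Finset.sum_congr rfl fun i _ => ?_
    rw [hvol, Finset.mul_sum]
    simp only [mul_ite, mul_one, mul_zero]
    rw [Finset.sum_ite_mem, Finset.univ_inter]
    exact Finset.sum_congr rfl fun v _ => mul_comm _ _
  have hE : signedEnergy G s (g a) ≤ 4 * b * ∑ i, a i ^ 2 * vol i := by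
    calc signedEnergy G s (g a)
        ≤ ∑ p ∈ adjPairs G, ∑ i, 2 * a i ^ 2 *
            (cutWeight s (P i).1 (P i).2 p.1 p.2 + cutWeight s (P i).1 (P i).2 p.2 p.1) := by
          refine Finset.sum_le_sum fun p hp => ?_
          rw [hg, hg]
          exact sum_mul_pairSign_sub_sq_le hd hP a (hs _ _ ((mem_adjPairs G).1 hp)) (hsym _ _)
      _ = ∑ i, 4 * a i ^ 2 * ∑ p ∈ adjPairs G, cutWeight s (P i).1 (P i).2 p.1 p.2 := by
          rw [Finset.sum_comm]
          refine Finset.sum_congr rfl fun i _ => ?_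
          rw [← Finset.mul_sum, Finset.sum_add_distrib,
            sum_adjPairs_swap G fun x y => cutWeight s (P i).1 (P i).2 x y]
          ring
      _ ≤ ∑ i, 4 * a i ^ 2 * (b * vol i) := by
          refine Finset.sum_le_sum fun i _ => mul_le_mul_of_nonneg_left ?_ (by positivity)
          have := hb i
          rwa [signedBeta_eq hsym, div_le_iff₀ (hvpos i)] at this
      _ = 4 * b * ∑ i, a i ^ 2 * vol i := by
          rw [Finset.mul_sum]
          exact Finset.sum_congr rfl fun i _ => by ring
  have hpos : 0 < ∑ i, a i ^ 2 * vol i := by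
    obtain ⟨i, hi⟩ := Function.ne_iff.1 ha0
    rw [Pi.zero_apply] at hi
    exact Finset.sum_pos' (fun k _ => mul_nonneg (sq_nonneg _) (hvpos k).le)
      ⟨i, Finset.mem_univ i, mul_pos (by positivity) (hvpos i)⟩
  rw [hM] at hlow
  have := le_of_mul_le_mul_right (hlow.trans hE) hpos
  linarith

omit [DecidableEq V] in
lemma exists_good_shift {m : ℕ} (hm : 0 < m)
    (q y : V → ℝ) (hq : ∀ v, 0 ≤ q v) (hpos : 0 < ∑ v, (G.degree v : ℝ) * q v) :
    ∃ t : ℕ, ∑ v, (G.degree v : ℝ) * q v *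
        (if latticeDist m (y v + t) < 1 ∨ latticeDist m (-y v + t) < 1 then 1 else 0)
          ≤ 12 * (∑ v, (G.degree v : ℝ) * q v) / m ∧
      ∑ p ∈ adjPairs G, min (q p.1) (q p.2) *
        (latticeGap m (y p.1 + t) (s p.1 p.2 * y p.2 + t) ^ 2 +
          latticeGap m (-y p.1 + t) (-(s p.1 p.2 * y p.2) + t) ^ 2)
          ≤ 16 / m * ∑ p ∈ adjPairs G, min (q p.1) (q p.2) * (y p.1 - s p.1 p.2 * y p.2) ^ 2 := by
  classical
  have hm' : (0 : ℝ) < m := by exact_mod_cast hm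
  have hmin : ∀ p : V × V, 0 ≤ min (q p.1) (q p.2) := fun p => le_min (hq _) (hq _)
  set M := ∑ v, (G.degree v : ℝ) * q v
  set D := ∑ p ∈ adjPairs G, min (q p.1) (q p.2) * (y p.1 - s p.1 p.2 * y p.2) ^ 2
  have hD : 0 ≤ D := Finset.sum_nonneg fun p _ => mul_nonneg (hmin p) (sq_nonneg _)
  have hne : (Finset.range m).Nonempty := Finset.nonempty_range_iff.2 hm.ne'
  obtain ⟨t, -, h1, h2⟩ := exists_le_two_mul_and_le_two_mul hne
    (fun t : ℕ => ∑ v, (G.degree v : ℝ) * q v *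
        (if latticeDist m (y v + t) < 1 ∨ latticeDist m (-y v + t) < 1 then 1 else 0))
    (fun t : ℕ => ∑ p ∈ adjPairs G, min (q p.1) (q p.2) *
        (latticeGap m (y p.1 + t) (s p.1 p.2 * y p.2 + t) ^ 2 +
          latticeGap m (-y p.1 + t) (-(s p.1 p.2 * y p.2) + t) ^ 2))
    (fun t _ => Finset.sum_nonneg fun v _ => mul_nonneg (mul_nonneg (Nat.cast_nonneg _) (hq v))
      (by positivity))
    (fun t _ => Finset.sum_nonneg fun p _ => mul_nonneg (hmin p) (by positivity))
    (A := 6 * M / m) (B := 8 / m * D) (by positivity) (by positivity)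
    (by
      rw [Finset.sum_comm, Finset.card_range, mul_div_cancel₀ _ hm'.ne', Finset.mul_sum]
      refine Finset.sum_le_sum fun v _ => ?_
      rw [← Finset.mul_sum, mul_comm 6]
      refine mul_le_mul_of_nonneg_left ?_ (mul_nonneg (Nat.cast_nonneg _) (hq v))
      rw [Finset.sum_boole, Finset.filter_or]
      have h1 := card_latticeDist_lt_one_le hm (y v)
      have h2 := card_latticeDist_lt_one_le hm (-y v)
      refine le_trans (Nat.cast_le.2 (Finset.card_union_le _ _)) ?_
      push_cast
      linarith)
    (by
      rw [Finset.sum_comm, Finset.card_range, ← mul_assoc, mul_div_cancel₀ _ hm'.ne',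
        Finset.mul_sum]
      refine Finset.sum_le_sum fun p _ => ?_
      rw [← Finset.mul_sum, mul_left_comm]
      refine mul_le_mul_of_nonneg_left ?_ (hmin p)
      rw [Finset.sum_add_distrib]
      have h1 := sum_latticeGap_sq_le hm (y p.1) (s p.1 p.2 * y p.2)
      have h2 := sum_latticeGap_sq_le hm (-y p.1) (-(s p.1 p.2 * y p.2))
      nlinarith)
  refine ⟨t, h1.trans (le_of_eq (by ring)), h2.trans (le_of_eq (by ring))⟩

section Localization

variable {ι : Type*} [Fintype ι]

/-- The direction of `x`, rescaled to length `r`. -/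
noncomputable def scaledDir (r : ℝ) (x : ι → ℝ) (i : ι) : ℝ := r * (x i / √(∑ l, x l ^ 2))

lemma scaledDir_neg (r : ℝ) (x : ι → ℝ) : scaledDir r (-x) = -scaledDir r x := by
  ext i
  simp only [scaledDir, Pi.neg_apply, neg_sq]
  ring

omit [DecidableEq V] in
/-- For an isotropic family, the mass of a single signed cell barely exceeds `1`. -/
lemma sum_cell_le [Nonempty ι] [DecidableEq (Sym2 (ι → ℤ))] {F : V → ι → ℝ}
    (hiso : ∀ x : ι → ℝ, ∑ v, (G.degree v : ℝ) * (∑ i, x i * F v i) ^ 2 = ∑ i, x i ^ 2)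
    {m : ℕ} (hm : 0 < m) (t : ι → ℕ) (c : Sym2 (ι → ℤ)) :
    ∑ v ∈ Finset.univ.filter fun v =>
        signedCell m t (scaledDir (4 * Fintype.card ι * m) (F v)) = c,
      (G.degree v : ℝ) * ∑ i, F v i ^ 2 ≤ 1 + 1 / (8 * Fintype.card ι) := by
  set k : ℝ := ((Fintype.card ι : ℕ) : ℝ) with hk
  have hk1 : 1 ≤ k := by
    rw [hk]; exact_mod_cast Fintype.card_pos
  have hm' : (0 : ℝ) < m := by exact_mod_cast hm
  set C := Finset.univ.filter fun v => signedCell m t (scaledDir (4 * k * m) (F v)) = c with hC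
  by_cases hz : ∀ v ∈ C, ∑ i, F v i ^ 2 = 0
  · rw [Finset.sum_eq_zero fun v hv => by rw [hz v hv, mul_zero]]
    positivity
  push Not at hz
  obtain ⟨v₀, hv₀, hq₀⟩ := hz
  have hx := sum_div_sqrt_sq hq₀
  set x : ι → ℝ := fun i => F v₀ i / √(∑ l, F v₀ l ^ 2) with hxdef
  have key : ∀ v ∈ C, (1 - 1 / (16 * k)) * ∑ i, F v i ^ 2 ≤ (∑ i, x i * F v i) ^ 2 := by
    intro v hv
    by_cases hq : ∑ i, F v i ^ 2 = 0
    · rw [hq, mul_zero]; positivity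
    have hqp : 0 < ∑ i, F v i ^ 2 :=
      lt_of_le_of_ne (Finset.sum_nonneg fun _ _ => sq_nonneg _) (Ne.symm hq)
    have hy := sum_div_sqrt_sq hq
    have hsq := Real.sq_sqrt hqp.le
    have ha : 0 < √(∑ l, F v l ^ 2) := Real.sqrt_pos.2 hqp
    set a := √(∑ l, F v l ^ 2)
    have hcell : signedCell m t (scaledDir (4 * k * m) (F v₀))
        = signedCell m t (scaledDir (4 * k * m) (F v)) :=
      (Finset.mem_filter.1 hv₀).2.trans (Finset.mem_filter.1 hv).2.symm
    have hbound : ∀ z : ι → ℝ, (∀ i, |4 * k * m * z i| ≤ m) → ∑ i, z i ^ 2 ≤ 1 / (16 * k) := by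
      intro z hz
      calc ∑ i, z i ^ 2 ≤ ∑ _i : ι, (1 / (4 * k)) ^ 2 := by
            refine Finset.sum_le_sum fun i _ => ?_
            rw [← sq_abs]
            refine pow_le_pow_left₀ (abs_nonneg _) ?_ 2
            have := hz i
            rw [abs_mul, abs_of_pos (by positivity : 0 < 4 * k * m)] at this
            rw [le_div_iff₀ (by positivity)]
            refine le_of_mul_le_mul_right ?_ hm'
            linarith
        _ = 1 / (16 * k) := by
            rw [Finset.sum_const, Finset.card_univ, nsmul_eq_mul, ← hk]
            field_simp
            norm_num
    have hin := one_sub_le_sq_inner_of_close hx hy (ε := 1 / (16 * k)) (by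
      refine (abs_le_of_signedCell_eq hm hcell).imp (fun h => hbound _ fun i => ?_)
        fun h => hbound _ fun i => ?_
      · have := h i
        simp only [scaledDir] at this
        rwa [← mul_sub] at this
      · have := h i
        simp only [scaledDir] at this
        rwa [← mul_add] at this)
    have e : ∑ i, x i * F v i = a * ∑ i, x i * (F v i / a) := by
      rw [Finset.mul_sum]
      refine Finset.sum_congr rfl fun i _ => ?_
      field_simp
    rw [e, mul_pow, hsq, mul_comm]
    exact mul_le_mul_of_nonneg_left hin hqp.le
  have h1 : (1 - 1 / (16 * k)) * ∑ v ∈ C, (G.degree v : ℝ) * ∑ i, F v i ^ 2 ≤ 1 := by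
    refine le_trans ?_ ((hiso x).trans hx).le
    rw [Finset.mul_sum]
    refine le_trans (Finset.sum_le_sum fun v hv => ?_)
      (Finset.sum_le_sum_of_subset_of_nonneg (Finset.subset_univ C)
        fun v _ _ => mul_nonneg (Nat.cast_nonneg _) (sq_nonneg _))
    rw [mul_left_comm]
    exact mul_le_mul_of_nonneg_left (key v hv) (Nat.cast_nonneg _)
  have h2 : 1 ≤ (1 - 1 / (16 * k)) * (1 + 1 / (8 * k)) := by
    have h3 : 1 / k ≤ 1 := by rw [div_le_one (by positivity)]; exact hk1
    have h4 : 0 < 1 / k := by positivity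
    have e1 : 1 / (16 * k) = 1 / 16 * (1 / k) := by field_simp
    have e2 : 1 / (8 * k) = 1 / 8 * (1 / k) := by field_simp
    rw [e1, e2]
    nlinarith
  have h5 : 0 < 1 - 1 / (16 * k) := by
    have : 1 / (16 * k) ≤ 1 / 16 := by
      apply one_div_le_one_div_of_le <;> linarith
    linarith
  exact le_of_mul_le_mul_left (h1.trans h2) h5

lemma sum_sq_sub_cellCutoff_smul_le [Nonempty ι] {m : ℕ} (hm : 0 < m) (t : ι → ℕ)
    (S : Finset (Sym2 (ι → ℤ))) (r : ℝ) (x y : ι → ℝ) {σ : ℝ} (hσ : σ = 1 ∨ σ = -1) :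
    ∑ l, (cellCutoff m t S (scaledDir r x) * x l
        - σ * (cellCutoff m t S (scaledDir r y) * y l)) ^ 2
      ≤ 2 * ∑ i, min (∑ l, x l ^ 2) (∑ l, y l ^ 2) *
          (latticeGap m (scaledDir r x i + t i) (σ * scaledDir r y i + t i) ^ 2 +
            latticeGap m (-scaledDir r x i + t i) (-(σ * scaledDir r y i) + t i) ^ 2)
        + 2 * ∑ i, (x i - σ * y i) ^ 2 := by
  wlog h1 : σ = 1 generalizing y σ
  · have h2 : σ = -1 := hσ.resolve_left h1
    have := this (-y) (Or.inl rfl) rfl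
    simpa only [scaledDir_neg, cellCutoff_neg, Pi.neg_apply, neg_sq, one_mul, h2, neg_mul, mul_neg]
      using this
  subst h1
  simp only [one_mul]
  have h := sum_sq_sub_smul_le x y (cellCutoff_nonneg hm t S (scaledDir r x))
    ((cellCutoff_le_wallDist hm t S _).trans (wallDist_le_one m t _))
    (cellCutoff_nonneg hm t S (scaledDir r y))
    ((cellCutoff_le_wallDist hm t S _).trans (wallDist_le_one m t _))
  refine h.trans (add_le_add_left (mul_le_mul_of_nonneg_left ?_ zero_le_two) _)
  rw [← Finset.mul_sum]
  exact mul_le_mul_of_nonneg_left (sq_sub_cellCutoff_le hm t S _ _)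
    (le_min (Finset.sum_nonneg fun _ _ => sq_nonneg _) (Finset.sum_nonneg fun _ _ => sq_nonneg _))

end Localization

section Partition

variable {ι : Type*} [Fintype ι]

omit [DecidableEq V] in
lemma exists_shifts [Nonempty ι] (hs : ∀ u v, G.Adj u v → s u v = 1 ∨ s u v = -1)
    {m : ℕ} (hm : 0 < m) (r : ℝ) {F : V → ι → ℝ}
    (hpos : 0 < ∑ v, (G.degree v : ℝ) * ∑ i, F v i ^ 2) :
    ∃ t : ι → ℕ,
      ∑ v ∈ Finset.univ.filter fun v => wallDist m t (scaledDir r (F v)) < 1,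
          (G.degree v : ℝ) * ∑ i, F v i ^ 2
        ≤ Fintype.card ι * (12 * (∑ v, (G.degree v : ℝ) * ∑ i, F v i ^ 2) / m) ∧
      ∑ p ∈ adjPairs G, ∑ i, min (∑ l, F p.1 l ^ 2) (∑ l, F p.2 l ^ 2) *
          (latticeGap m (scaledDir r (F p.1) i + t i)
              (s p.1 p.2 * scaledDir r (F p.2) i + t i) ^ 2 +
            latticeGap m (-scaledDir r (F p.1) i + t i)
              (-(s p.1 p.2 * scaledDir r (F p.2) i) + t i) ^ 2)
        ≤ 16 / m * (r ^ 2 * ∑ i, signedEnergy G s fun v => F v i) := by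
  classical
  have hq : ∀ v, 0 ≤ ∑ i, F v i ^ 2 := fun v => Finset.sum_nonneg fun _ _ => sq_nonneg _
  choose t ht1 ht2 using fun i : ι => exists_good_shift (s := s) hm (fun v => ∑ l, F v l ^ 2)
    (fun v => scaledDir r (F v) i) hq hpos
  refine ⟨t, ?_, ?_⟩
  · have h := Finset.sum_le_sum fun i (_ : i ∈ Finset.univ) => ht1 i
    rw [Finset.sum_const, Finset.card_univ, nsmul_eq_mul, Finset.sum_comm] at h
    refine le_trans ?_ h
    rw [Finset.sum_filter]
    refine Finset.sum_le_sum fun v _ => ?_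
    rw [← Finset.mul_sum]
    have hn : ∀ i ∈ Finset.univ, (0 : ℝ) ≤ if latticeDist m (scaledDir r (F v) i + t i) < 1 ∨
        latticeDist m (-scaledDir r (F v) i + t i) < 1 then 1 else 0 := fun _ _ => by positivity
    split_ifs with hw
    · refine le_mul_of_one_le_right (mul_nonneg (Nat.cast_nonneg _) (hq v)) ?_
      obtain ⟨i, hi⟩ := exists_wallDist_eq m t (scaledDir r (F v))
      rw [hi, min_lt_iff] at hw
      refine le_trans (le_of_eq ?_) (Finset.single_le_sum hn (Finset.mem_univ i))
      rw [if_pos hw]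
    · exact mul_nonneg (mul_nonneg (Nat.cast_nonneg _) (hq v)) (Finset.sum_nonneg hn)
  · rw [Finset.sum_comm]
    refine (Finset.sum_le_sum fun i _ => ht2 i).trans ?_
    rw [← Finset.mul_sum]
    refine mul_le_mul_of_nonneg_left ?_ (by positivity)
    simp only [signedEnergy]
    rw [Finset.sum_comm, Finset.sum_comm (s := Finset.univ), Finset.mul_sum]
    refine Finset.sum_le_sum fun p hp => ?_
    have h := mul_le_mul_of_nonneg_left
      (min_mul_sum_sq_sub_normalized_le (F p.1) (s p.1 p.2 • F p.2)) (sq_nonneg r)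
    have hsq : s p.1 p.2 ^ 2 = 1 := by
      rcases hs _ _ ((mem_adjPairs G).1 hp) with h | h <;> rw [h] <;> norm_num
    simp only [Pi.smul_apply, smul_eq_mul, mul_pow, hsq, one_mul] at h
    refine le_trans (le_of_eq ?_) h
    rw [mul_left_comm, Finset.mul_sum, Finset.mul_sum]
    refine Finset.sum_congr rfl fun i _ => ?_
    simp only [scaledDir]
    ring

omit [DecidableEq V] in
lemma sum_signedEnergy_cellCutoff_le [Nonempty ι]
    (hs : ∀ u v, G.Adj u v → s u v = 1 ∨ s u v = -1) {m : ℕ} (hm : 0 < m) (t : ι → ℕ)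
    (S : Finset (Sym2 (ι → ℤ))) (r : ℝ) (F : V → ι → ℝ) :
    ∑ l, signedEnergy G s (fun v => cellCutoff m t S (scaledDir r (F v)) * F v l)
      ≤ 2 * ∑ p ∈ adjPairs G, ∑ i, min (∑ l, F p.1 l ^ 2) (∑ l, F p.2 l ^ 2) *
          (latticeGap m (scaledDir r (F p.1) i + t i)
              (s p.1 p.2 * scaledDir r (F p.2) i + t i) ^ 2 +
            latticeGap m (-scaledDir r (F p.1) i + t i)
              (-(s p.1 p.2 * scaledDir r (F p.2) i) + t i) ^ 2)
        + 2 * ∑ i, signedEnergy G s fun v => F v i := by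
  simp only [signedEnergy]
  rw [Finset.sum_comm, Finset.sum_comm (s := Finset.univ) (t := adjPairs G), Finset.mul_sum,
    Finset.mul_sum, ← Finset.sum_add_distrib]
  exact Finset.sum_le_sum fun p hp =>
    sum_sq_sub_cellCutoff_smul_le hm t S r _ _ (hs _ _ ((mem_adjPairs G).1 hp))

omit [DecidableEq V] in
lemma sum_degree_mul_sum_sq_of_isotropic {F : V → ι → ℝ}
    (hiso : ∀ x : ι → ℝ, ∑ v, (G.degree v : ℝ) * (∑ i, x i * F v i) ^ 2 = ∑ i, x i ^ 2) :
    ∑ v, (G.degree v : ℝ) * ∑ i, F v i ^ 2 = Fintype.card ι := by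
  classical
  simp only [Finset.mul_sum]
  rw [Finset.sum_comm]
  have h : ∀ i, ∑ v, (G.degree v : ℝ) * F v i ^ 2 = 1 := by
    intro i
    have := hiso (Pi.single i 1)
    simpa [Pi.single_apply] using this
  simp [h]

omit [DecidableEq V] in
/-- Unions of signed cells that carry disjoint portions of an isotropic family, each of mass at
least `1 / 2` away from the walls. -/
lemma exists_cell_groups [Nonempty ι] {F : V → ι → ℝ}
    (hiso : ∀ x : ι → ℝ, ∑ v, (G.degree v : ℝ) * (∑ i, x i * F v i) ^ 2 = ∑ i, x i ^ 2)
    {m : ℕ} (hm : 0 < m) (t : ι → ℕ)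
    (hbad : ∑ v ∈ Finset.univ.filter fun v =>
        wallDist m t (scaledDir (4 * Fintype.card ι * m) (F v)) < 1,
      (G.degree v : ℝ) * ∑ i, F v i ^ 2 ≤ 1 / 4) :
    ∃ P : Fin (Fintype.card ι) → Finset (Sym2 (ι → ℤ)),
      (∀ i i', i ≠ i' → Disjoint (P i) (P i')) ∧
      ∀ i, 1 / 2 ≤ ∑ l, ∑ v, (G.degree v : ℝ) *
        (cellCutoff m t (P i) (scaledDir (4 * Fintype.card ι * m) (F v)) * F v l) ^ 2 := by
  classical
  set k : ℝ := ((Fintype.card ι : ℕ) : ℝ) with hk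
  have hk1 : 1 ≤ k := by
    rw [hk]; exact_mod_cast Fintype.card_pos
  have hM := sum_degree_mul_sum_sq_of_isotropic hiso
  rw [← hk] at hM
  set Y : V → ι → ℝ := fun v => scaledDir (4 * k * m) (F v) with hY
  set μ : V → ℝ := fun v => (G.degree v : ℝ) * ∑ i, F v i ^ 2 with hμ
  have hμ0 : ∀ v, 0 ≤ μ v := fun v => by positivity
  set good : Finset V := Finset.univ.filter fun v => ¬ wallDist m t (Y v) < 1 with hgood
  have hsplit : ∑ v ∈ good, μ v ≥ k - 1 / 4 := by
    have := Finset.sum_filter_add_sum_filter_not Finset.univ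
      (fun v => wallDist m t (Y v) < 1) μ
    have h2 : ∑ v, μ v = k := hM
    have h3 : ∑ v ∈ Finset.univ.filter (fun v => wallDist m t (Y v) < 1), μ v ≤ 1 / 4 := hbad
    linarith
  set w : Sym2 (ι → ℤ) → ℝ := fun c =>
    ∑ v ∈ good.filter fun v => signedCell m t (Y v) = c, μ v with hw
  have hinv : 0 < 1 / (8 * k) := by positivity
  have hkinv : k * (1 / (8 * k)) = 1 / 8 := by field_simp
  obtain ⟨P, -, hdisj, hP⟩ := exists_groups w (b := 1 + 1 / (8 * k)) (by linarith)
    (fun c => by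
      refine le_trans ?_ (sum_cell_le hiso hm t c)
      exact Finset.sum_le_sum_of_subset_of_nonneg
        (Finset.filter_subset_filter _ (Finset.subset_univ _)) fun v _ _ => hμ0 v)
    (Fintype.card ι) (good.image fun v => signedCell m t (Y v)) (by
      rw [hw, Finset.sum_fiberwise_of_maps_to fun v hv => Finset.mem_image_of_mem _ hv, ← hk,
        mul_add, hkinv]
      linarith)
  refine ⟨P, hdisj, fun i => ?_⟩
  have h1 : 1 / 2 ≤ ∑ c ∈ P i, w c := by
    have := hP i
    linarith
  refine h1.trans ?_
  rw [Finset.sum_comm]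
  have h2 : ∑ c ∈ P i, w c = ∑ v ∈ good.filter fun v => signedCell m t (Y v) ∈ P i, μ v := by
    rw [← Finset.sum_fiberwise_of_maps_to (s := good.filter fun v => signedCell m t (Y v) ∈ P i)
      (t := P i) (g := fun v => signedCell m t (Y v)) fun v hv => (Finset.mem_filter.1 hv).2]
    refine Finset.sum_congr rfl fun c hc => ?_
    rw [hw]
    refine Finset.sum_congr ?_ fun _ _ => rfl
    ext v
    simp only [Finset.mem_filter]
    refine ⟨fun h => ⟨⟨h.1, h.2 ▸ hc⟩, h.2⟩, fun h => ⟨h.1.1, h.2⟩⟩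
  rw [h2]
  refine le_trans (Finset.sum_le_sum fun v hv => ?_)
    (Finset.sum_le_sum_of_subset_of_nonneg (Finset.subset_univ _)
      fun v _ _ => Finset.sum_nonneg fun l _ => by positivity)
  rw [← Finset.mul_sum]
  obtain ⟨hv1, hv2⟩ := Finset.mem_filter.1 hv
  have h3 : cellCutoff m t (P i) (scaledDir (4 * k * m) (F v)) = 1 := by
    rw [cellCutoff, if_pos hv2]
    exact le_antisymm (wallDist_le_one _ _ _) (not_lt.1 (Finset.mem_filter.1 hv1).2)
  refine le_of_eq (congrArg _ (Finset.sum_congr rfl fun l _ => ?_))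
  rw [h3, one_mul]

/-- An isotropic family of `k` functions yields `k` disjoint pairs with bipartiteness ratio
controlled by the total energy of the family. -/
lemma exists_pairs_signedBeta_sq_le [Nonempty ι] (hdeg : ∀ v, 0 < G.degree v)
    (hs : ∀ u v, G.Adj u v → s u v = 1 ∨ s u v = -1) (hsym : ∀ u v, s u v = s v u)
    {F : V → ι → ℝ}
    (hiso : ∀ x : ι → ℝ, ∑ v, (G.degree v : ℝ) * (∑ i, x i * F v i) ^ 2 = ∑ i, x i ^ 2) :
    ∃ P : Fin (Fintype.card ι) → Finset V × Finset V,
      (∀ i, Disjoint (P i).1 (P i).2) ∧ (∀ i, ((P i).1 ∪ (P i).2).Nonempty) ∧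
      (∀ i i', i ≠ i' → Disjoint ((P i).1 ∪ (P i).2) ((P i').1 ∪ (P i').2)) ∧
      ∀ i, signedBeta G s (P i).1 (P i).2 ^ 2
        ≤ 50000 * (Fintype.card ι : ℝ) ^ 4 * ∑ i, signedEnergy G s fun v => F v i := by
  classical
  have hkn : 0 < Fintype.card ι := Fintype.card_pos
  have hM := sum_degree_mul_sum_sq_of_isotropic hiso
  set k : ℝ := ((Fintype.card ι : ℕ) : ℝ) with hk
  have hk1 : 1 ≤ k := by rw [hk]; exact_mod_cast hkn
  set m := 48 * Fintype.card ι ^ 2 with hmdef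
  have hm : 0 < m := by positivity
  have hmk : (m : ℝ) = 48 * k ^ 2 := by rw [hmdef]; push_cast; rfl
  set E := ∑ i, signedEnergy G s fun v => F v i with hE
  have hE0 : 0 ≤ E := Finset.sum_nonneg fun i _ => signedEnergy_nonneg _
  obtain ⟨t, ht1, ht2⟩ := exists_shifts hs hm (4 * k * m) (F := F) (by rw [hM]; linarith)
  obtain ⟨P, hdisj, hP⟩ := exists_cell_groups hiso hm t (ht1.trans (le_of_eq (by
    rw [hM, hmk, ← hk]
    field_simp
    norm_num)))
  rw [← hk] at hP
  have hk4 : 1 ≤ k ^ 4 := one_le_pow₀ hk1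
  have main : ∀ i, ∃ A B : Finset V, Disjoint A B ∧ (A ∪ B).Nonempty ∧
      (∀ v ∈ A ∪ B, signedCell m t (scaledDir (4 * k * m) (F v)) ∈ P i) ∧
      signedBeta G s A B ^ 2 ≤ 50000 * k ^ 4 * E := by
    intro i
    have hen := sum_signedEnergy_cellCutoff_le hs hm t (P i) (4 * k * m) F
    obtain ⟨l, -, hl0, hl⟩ := exists_pos_and_le_mul Finset.univ
      (fun l => signedEnergy G s fun v =>
        cellCutoff m t (P i) (scaledDir (4 * k * m) (F v)) * F v l)
      (fun l => ∑ v, (G.degree v : ℝ) *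
        (cellCutoff m t (P i) (scaledDir (4 * k * m) (F v)) * F v l) ^ 2)
      (Q := 50000 * k ^ 4 * E)
      (fun l _ => signedEnergy_nonneg _) (fun l _ => by positivity)
      (lt_of_lt_of_le (by norm_num) (hP i))
      (by
        have h3 : 16 / (m : ℝ) * ((4 * k * m) ^ 2 * E) = 12288 * (k ^ 4 * E) := by
          rw [hmk]; field_simp; ring
        rw [h3] at ht2
        have h5 := mul_le_mul_of_nonneg_left (hP i) (by positivity : 0 ≤ 50000 * k ^ 4 * E)
        have h6 : E ≤ k ^ 4 * E := le_mul_of_one_le_left hE0 hk4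
        nlinarith)
    obtain ⟨A, B, hAB, hne, hsupp, hb⟩ := exists_pair_signedBeta_sq_le hdeg hs hsym
      (fun v => cellCutoff m t (P i) (scaledDir (4 * k * m) (F v)) * F v l) (by
        by_contra! h0
        simp [h0] at hl0)
    refine ⟨A, B, hAB, hne, fun v hv => ?_, le_of_mul_le_mul_right (hb.trans hl) hl0⟩
    by_contra hc
    exact hsupp v hv (by rw [cellCutoff, if_neg hc, zero_mul])
  choose A B hAB hne hsupp hb using main
  refine ⟨fun i => (A i, B i), hAB, hne, fun i i' hii => ?_, hb⟩
  exact Finset.disjoint_left.2 fun v hv hv' =>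
    Finset.disjoint_left.1 (hdisj i i' hii) (hsupp i v hv) (hsupp i' v hv')

end Partition

lemma exists_pairs_signedBeta_sq_le_eigenvalue (hdeg : ∀ v, 0 < G.degree v)
    (hs : ∀ u v, G.Adj u v → s u v = 1 ∨ s u v = -1) (hsym : ∀ u v, s u v = s v u)
    {lam : Fin (Fintype.card V) → ℝ} {u : Fin (Fintype.card V) → V → ℝ}
    (hmono : Monotone lam) (hlam : ∀ i, slap G s (u i) = lam i • u i)
    (hu : ∀ i j, (∑ v, (G.degree v : ℝ) * u i v * u j v) = if i = j then 1 else 0)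
    (l : Fin (Fintype.card V)) :
    ∃ P : Fin (l + 1) → Finset V × Finset V,
      (∀ i, Disjoint (P i).1 (P i).2) ∧ (∀ i, ((P i).1 ∪ (P i).2).Nonempty) ∧
      (∀ i i', i ≠ i' → Disjoint ((P i).1 ∪ (P i).2) ((P i').1 ∪ (P i').2)) ∧
      ∀ i, signedBeta G s (P i).1 (P i).2 ^ 2 ≤ 100000 * ((l : ℕ) + 1 : ℝ) ^ 5 * lam l := by
  set e : Fin (l + 1) → Fin (Fintype.card V) := fun i => ⟨i, by omega⟩ with he
  have hinj : Function.Injective e := fun a b h => Fin.ext (Fin.mk.inj_iff.1 h)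
  have hiso : ∀ x : Fin (l + 1) → ℝ,
      ∑ v, (G.degree v : ℝ) * (∑ i, x i * u (e i) v) ^ 2 = ∑ i, x i ^ 2 := by
    intro x
    calc ∑ v, (G.degree v : ℝ) * (∑ i, x i * u (e i) v) ^ 2
        = ∑ v, ∑ i, ∑ i', x i * x i' * ((G.degree v : ℝ) * u (e i) v * u (e i') v) := by
          refine Finset.sum_congr rfl fun v _ => ?_
          rw [sq, Finset.sum_mul_sum, Finset.mul_sum]
          refine Finset.sum_congr rfl fun i _ => ?_
          rw [Finset.mul_sum]
          exact Finset.sum_congr rfl fun i' _ => by ring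
      _ = ∑ i, ∑ i', x i * x i' * ∑ v, (G.degree v : ℝ) * u (e i) v * u (e i') v := by
          rw [Finset.sum_comm]
          refine Finset.sum_congr rfl fun i _ => ?_
          rw [Finset.sum_comm]
          exact Finset.sum_congr rfl fun i' _ => (Finset.mul_sum _ _ _).symm
      _ = ∑ i, x i ^ 2 := by
          simp [hu, hinj.eq_iff, sq]
  obtain ⟨P, h1, h2, h3, h4⟩ := exists_pairs_signedBeta_sq_le hdeg hs hsym hiso
  have hE : ∑ i, signedEnergy G s (fun v => u (e i) v) ≤ ((l : ℕ) + 1 : ℝ) * (2 * lam l) := by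
    refine (Finset.sum_le_card_nsmul _ _ (2 * lam l) fun i _ => ?_).trans (le_of_eq ?_)
    · refine (signedEnergy_eigenvector hdeg hs hlam hu (e i)).le.trans ?_
      have : e i ≤ l := Fin.mk_le_mk.2 (by omega)
      linarith [hmono this]
    · simp
  let c : Fin (l + 1) → Fin (Fintype.card (Fin (l + 1))) := Fin.cast (Fintype.card_fin _).symm
  have hc : ∀ i i', i ≠ i' → c i ≠ c i' := fun i i' h => (Fin.cast_injective _).ne h
  refine ⟨fun i => P (c i), fun i => h1 _, fun i => h2 _, fun i i' h => h3 _ _ (hc i i' h),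
    fun i => (h4 _).trans ?_⟩
  rw [Fintype.card_fin]
  push_cast
  refine (mul_le_mul_of_nonneg_left hE (by positivity)).trans (le_of_eq (by ring))

end SignedGraph

/-- Higher-order signed Cheeger inequalities (Atay–Liu): there is an absolute constant `C > 0`
such that for every finite signed graph without isolated vertices and every `j ∈ {1,…,N}`,
`(h_j^s)²/(C j⁶) ≤ λ_j ≤ 2 h_j^s`. The eigenvalues are encoded by a monotone list `lam`
together with an eigenbasis `u`, orthonormal with respect to the degree-weighted
inner product. -/
theorem stmt9 :
    ∃ C : ℝ, 0 < C ∧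
      ∀ (V : Type) [Fintype V] [DecidableEq V] (G : SimpleGraph V) [DecidableRel G.Adj]
        (s : V → V → ℝ),
        (∀ v, 0 < G.degree v) →
        (∀ u v, G.Adj u v → s u v = 1 ∨ s u v = -1) →
        (∀ u v, s u v = s v u) →
        ∀ (lam : Fin (Fintype.card V) → ℝ), Monotone lam →
        ∀ u : Fin (Fintype.card V) → V → ℝ,
        (∀ i, slap G s (u i) = lam i • u i) →
        (∀ i j, (∑ v, (G.degree v : ℝ) * u i v * u j v) = if i = j then 1 else 0) →
        ∀ (j : ℕ) (hj1 : 1 ≤ j) (hj2 : j ≤ Fintype.card V),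
          signedCheegerJ G s j ^ 2 / (C * (j : ℝ) ^ 6) ≤ lam ⟨j - 1, by omega⟩ ∧
            lam ⟨j - 1, by omega⟩ ≤ 2 * signedCheegerJ G s j := by
  refine ⟨100000, by norm_num, ?_⟩
  intro V _ _ G _ s hdeg hs hsym lam hmono u hlam hu j hj1 hj2
  obtain ⟨l, rfl⟩ : ∃ l, j = l + 1 := ⟨j - 1, by omega⟩
  simp only [Nat.add_sub_cancel]
  obtain ⟨P, hd, hne, hP, hb⟩ := exists_pairs_signedBeta_sq_le_eigenvalue hdeg hs hsym hmono hlam hu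
    ⟨l, by omega⟩
  have hlam0 : 0 ≤ lam ⟨l, by omega⟩ := by
    have h := signedEnergy_eigenvector hdeg hs hlam hu ⟨l, by omega⟩
    have := signedEnergy_nonneg (G := G) (s := s) (u ⟨l, by omega⟩)
    linarith
  have hnonneg : ∀ Q : Fin (l + 1) → Finset V × Finset V,
      0 ≤ sSup (Set.range fun i => signedBeta G s (Q i).1 (Q i).2) := fun Q =>
    Real.sSup_nonneg (by rintro _ ⟨i, rfl⟩; exact signedBeta_nonneg hsym _ _)
  refine ⟨?_, ?_⟩
  · have h0 : 0 ≤ signedCheegerJ G s (l + 1) :=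
      Real.sInf_nonneg (by rintro _ ⟨Q, -, -, -, rfl⟩; exact hnonneg Q)
    have h1 : signedCheegerJ G s (l + 1) ≤ √(100000 * ((l : ℝ) + 1) ^ 5 * lam ⟨l, by omega⟩) := by
      rw [signedCheegerJ]
      refine le_trans (csInf_le ⟨0, ?_⟩ ⟨P, hd, hne, hP, rfl⟩)
        (csSup_le (Set.range_nonempty _) ?_)
      · rintro _ ⟨Q, -, -, -, rfl⟩
        exact hnonneg Q
      · rintro _ ⟨i, rfl⟩
        exact Real.le_sqrt_of_sq_le (hb i)
    have h2 := pow_le_pow_left₀ h0 h1 2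
    rw [Real.sq_sqrt (by positivity)] at h2
    rw [div_le_iff₀ (by positivity)]
    refine h2.trans ?_
    push_cast
    have h3 : ((l : ℝ) + 1) ^ 5 ≤ ((l : ℝ) + 1) ^ 6 :=
      pow_le_pow_right₀ (by linarith [Nat.cast_nonneg (α := ℝ) l]) (by norm_num)
    have h4 := mul_le_mul_of_nonneg_right h3 hlam0
    linarith
  · rw [← div_le_iff₀' two_pos]
    refine le_csInf ⟨_, ⟨P, hd, hne, hP, rfl⟩⟩ ?_
    rintro _ ⟨Q, hd, hne, hQ, rfl⟩
    rw [div_le_iff₀' two_pos]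
    exact eigenvalue_le_two_mul_of_signedBeta_le hdeg hs hsym hmono hlam hu _ (Nat.lt_succ_self l)
      hd hne hQ fun i => le_csSup (Set.finite_range _).bddAbove ⟨i, rfl⟩
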